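/- arXiv:2508.12747 — 3 statements merged into one kernel-verified Lean document; each statement's English description precedes it below -/
import Mathlib

section
/- There exists a finite simple graph that admits a planar storyplan but does not admit a planar geometric storyplan. -/
/-- The topological drawing of the subgraph of `G` induced by the visible vertex
set `S`, with vertex placement `D` and edge curves `γ`, is planar. -/
def IsPlanarTopoFrame {V : Type*} (G : SimpleGraph V) (S : Set V)
    (D : V → ℝ × ℝ) (γ : ∀ u v, G.Adj u v → Path (D u) (D v)) : Prop :=
  Set.InjOn D S ∧
  (∀ u v (h : G.Adj u v) w, u ∈ S → v ∈ S → w ∈ S →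
      D w ∈ Set.range ⇑(γ u v h) → w = u ∨ w = v) ∧
  (∀ u v x y (h₁ : G.Adj u v) (h₂ : G.Adj x y), u ∈ S → v ∈ S → x ∈ S → y ∈ S →
      ¬((u = x ∧ v = y) ∨ (u = y ∧ v = x)) →
      ∀ p ∈ Set.range ⇑(γ u v h₁) ∩ Set.range ⇑(γ x y h₂),
        ∃ z, (z = u ∨ z = v) ∧ (z = x ∨ z = y) ∧ p = D z)

/-- `G` admits a planar (topological) storyplan: there are `len ≥ 1` time steps,
each vertex `v` is visible on a nonempty interval `[s v, e v] ⊆ [1, len]`,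
every vertex gets a point `D v ∈ ℝ²` and every edge `uv` gets a simple
(injective) curve from `D u` to `D v` (one curve per edge, independent of
orientation), the endpoints of every edge co-occur, and every frame is a
planar topological drawing. -/
def HasPlanarStoryplan {V : Type*} (G : SimpleGraph V) : Prop :=
  ∃ (len : ℕ) (s e : V → ℕ) (D : V → ℝ × ℝ)
      (γ : ∀ u v, G.Adj u v → Path (D u) (D v)),
    1 ≤ len ∧
    (∀ v, 1 ≤ s v ∧ s v ≤ e v ∧ e v ≤ len) ∧
    (∀ u v (h : G.Adj u v), γ v u h.symm = (γ u v h).symm) ∧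
    (∀ u v (h : G.Adj u v), Function.Injective ⇑(γ u v h)) ∧
    (∀ u v, G.Adj u v → ∃ t, s u ≤ t ∧ t ≤ e u ∧ s v ≤ t ∧ t ≤ e v) ∧
    (∀ t, 1 ≤ t → t ≤ len → IsPlanarTopoFrame G {v | s v ≤ t ∧ t ≤ e v} D γ)

/-- The straight-line drawing `D` of the subgraph of `G` induced by the visible
vertex set `S` is planar. -/
def IsPlanarSLFrame {V : Type*} (G : SimpleGraph V) (S : Set V) (D : V → ℝ × ℝ) : Prop :=
  Set.InjOn D S ∧
  (∀ u v w, G.Adj u v → u ∈ S → v ∈ S → w ∈ S → w ≠ u → w ≠ v →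
      D w ∉ openSegment ℝ (D u) (D v)) ∧
  (∀ u v x y, G.Adj u v → G.Adj x y → u ∈ S → v ∈ S → x ∈ S → y ∈ S →
      ¬((u = x ∧ v = y) ∨ (u = y ∧ v = x)) →
      ∀ p ∈ segment ℝ (D u) (D v) ∩ segment ℝ (D x) (D y),
        ∃ z, (z = u ∨ z = v) ∧ (z = x ∨ z = y) ∧ p = D z)

/-- `(len, s, e, D)` is a planar geometric storyplan of `G`: `len ≥ 1` time steps,
each vertex `v` is visible on the nonempty interval `[s v, e v] ⊆ [1, len]`,
the endpoints of every edge co-occur, and every frame is a planar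
straight-line drawing. -/
def IsGeomStoryplan {V : Type*} (G : SimpleGraph V)
    (len : ℕ) (s e : V → ℕ) (D : V → ℝ × ℝ) : Prop :=
  1 ≤ len ∧
  (∀ v, 1 ≤ s v ∧ s v ≤ e v ∧ e v ≤ len) ∧
  (∀ u v, G.Adj u v → ∃ t, s u ≤ t ∧ t ≤ e u ∧ s v ≤ t ∧ t ≤ e v) ∧
  (∀ t, 1 ≤ t → t ≤ len → IsPlanarSLFrame G {v | s v ≤ t ∧ t ≤ e v} D)

/-- `G` admits a planar geometric storyplan. -/
def HasGeomStoryplan {V : Type*} (G : SimpleGraph V) : Prop :=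
  ∃ len s e D, IsGeomStoryplan G len s e D


/-! ### Elementary plane geometry -/

/-- Orientation determinant. -/
def orD (a b c : ℝ × ℝ) : ℝ := (b.1 - a.1) * (c.2 - a.2) - (b.2 - a.2) * (c.1 - a.1)

/-- `p` is strictly inside the triangle `a b c`. -/
def Ins (a b c p : ℝ × ℝ) : Prop :=
  0 < orD a b c * orD p b c ∧ 0 < orD a b c * orD a p c ∧ 0 < orD a b c * orD a b p

lemma Ins.swap12 {a b c p : ℝ × ℝ} (h : Ins a b c p) : Ins b a c p := by
  obtain ⟨h1, h2, h3⟩ := h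
  refine ⟨?_, ?_, ?_⟩
  · convert h2 using 1; simp only [orD]; ring
  · convert h1 using 1; simp only [orD]; ring
  · convert h3 using 1; simp only [orD]; ring

lemma Ins.swap23 {a b c p : ℝ × ℝ} (h : Ins a b c p) : Ins a c b p := by
  obtain ⟨h1, h2, h3⟩ := h
  refine ⟨?_, ?_, ?_⟩
  · convert h1 using 1; simp only [orD]; ring
  · convert h3 using 1; simp only [orD]; ring
  · convert h2 using 1; simp only [orD]; ring

lemma mem_seg_of {a b p : ℝ × ℝ} {x y : ℝ} (hx : 0 ≤ x) (hy : 0 ≤ y) (h : x + y = 1)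
    (h1 : p.1 = x * a.1 + y * b.1) (h2 : p.2 = x * a.2 + y * b.2) : p ∈ segment ℝ a b := by
  refine ⟨x, y, hx, hy, h, ?_⟩
  ext <;> simp [h1, h2]

/-- A segment leaving a triangle meets its boundary. -/
lemma cross_boundary {a b c p q : ℝ × ℝ} (hD : orD a b c ≠ 0) (hp : Ins a b c p)
    (hq : ¬ Ins a b c q) :
    ∃ r ∈ segment ℝ p q, r ∈ segment ℝ a b ∨ r ∈ segment ℝ b c ∨ r ∈ segment ℝ a c := by
  obtain ⟨p1, p2, p3⟩ := hp
  let L : ℝ → ℝ × ℝ := fun t => ((1 - t) * p.1 + t * q.1, (1 - t) * p.2 + t * q.2)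
  let A : ℝ → ℝ := fun t => orD a b c * orD (L t) b c
  let B : ℝ → ℝ := fun t => orD a b c * orD a (L t) c
  let C : ℝ → ℝ := fun t => orD a b c * orD a b (L t)
  let M : ℝ → ℝ := fun t => min (A t) (min (B t) (C t))
  have L0 : L 0 = p := by ext <;> simp [L]
  have L1 : L 1 = q := by ext <;> simp [L]
  have hc : Continuous M := by
    simp only [M, A, B, C, L, orD]; fun_prop
  have h0 : 0 ≤ M 0 := by
    simp only [M, A, B, C, L0]
    exact le_min p1.le (le_min p2.le p3.le)
  have h1 : M 1 ≤ 0 := by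
    by_contra h
    push Not at h
    simp only [M, A, B, C, L1, lt_min_iff] at h
    exact hq h
  obtain ⟨t, ⟨ht0, ht1⟩, ht⟩ := intermediate_value_Icc' zero_le_one hc.continuousOn ⟨h1, h0⟩
  have hA : 0 ≤ A t := ht ▸ min_le_left _ _
  have hB : 0 ≤ B t := ht ▸ (min_le_right _ _).trans (min_le_left _ _)
  have hC : 0 ≤ C t := ht ▸ (min_le_right _ _).trans (min_le_right _ _)
  have hz : A t = 0 ∨ B t = 0 ∨ C t = 0 := by
    simp only [M] at ht
    rcases min_choice (A t) (min (B t) (C t)) with h | h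
    · left; rw [← h]; exact ht
    · rcases min_choice (B t) (C t) with h' | h'
      · right; left; rw [← h', ← h]; exact ht
      · right; right; rw [← h', ← h]; exact ht
  have hS : A t + B t + C t = orD a b c ^ 2 := by simp only [A, B, C, orD]; ring
  have hX : orD a b c ^ 2 * (L t).1 = A t * a.1 + B t * b.1 + C t * c.1 := by
    simp only [A, B, C, orD]; ring
  have hY : orD a b c ^ 2 * (L t).2 = A t * a.2 + B t * b.2 + C t * c.2 := by
    simp only [A, B, C, orD]; ring
  have hD2 : 0 < orD a b c ^ 2 := by positivity
  set E := orD a b c ^ 2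
  refine ⟨L t, mem_seg_of (x := 1 - t) (y := t) (by linarith) ht0 (by ring) rfl rfl, ?_⟩
  have key : ∀ {u v : ℝ} {a b : ℝ × ℝ}, 0 ≤ u → 0 ≤ v → u + v = E →
      E * (L t).1 = u * a.1 + v * b.1 → E * (L t).2 = u * a.2 + v * b.2 →
      L t ∈ segment ℝ a b := by
    intro u v a b hu hv huv e1 e2
    refine mem_seg_of (x := u / E) (y := v / E) (by positivity) (by positivity) ?_ ?_ ?_
    · field_simp; exact huv
    · field_simp; linarith
    · field_simp; linarith
  rcases hz with h | h | h
  · right; left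
    exact key hB hC (by linarith) (by rw [hX, h]; ring) (by rw [hY, h]; ring)
  · right; right
    exact key hA hC (by linarith) (by rw [hX, h]; ring) (by rw [hY, h]; ring)
  · left
    exact key hA hB (by linarith) (by rw [hX, h]; ring) (by rw [hY, h]; ring)

/-- Collinear points: one lies in the segment of the others. -/
lemma collinear_cases {a b c : ℝ × ℝ} (h : orD a b c = 0) :
    a ∈ segment ℝ b c ∨ b ∈ segment ℝ a c ∨ c ∈ segment ℝ a b := by
  have hcol : Collinear ℝ ({a, b, c} : Set (ℝ × ℝ)) := by
    rw [collinear_iff_of_mem (p₀ := a) (by simp)]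
    by_cases hab : a = b
    · refine ⟨c - a, ?_⟩
      intro p hp
      simp only [Set.mem_insert_iff, Set.mem_singleton_iff] at hp
      rcases hp with rfl | rfl | rfl
      · exact ⟨0, by simp⟩
      · exact ⟨0, by simp [hab]⟩
      · exact ⟨1, by simp⟩
    · refine ⟨b - a, ?_⟩
      intro p hp
      simp only [Set.mem_insert_iff, Set.mem_singleton_iff] at hp
      rcases hp with rfl | rfl | rfl
      · exact ⟨0, by simp⟩
      · exact ⟨1, by simp⟩
      · simp only [orD] at h
        by_cases h1 : b.1 - a.1 = 0
        · have h2 : b.2 - a.2 ≠ 0 := by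
            intro h2; apply hab; ext <;> linarith
          refine ⟨(p.2 - a.2) / (b.2 - a.2), ?_⟩
          have h3 : p.1 - a.1 = 0 := by
            rw [h1] at h
            have : (b.2 - a.2) * (p.1 - a.1) = 0 := by linarith
            exact (mul_eq_zero.mp this).resolve_left h2
          ext
          · simp [h1]; linarith
          · simp; field_simp; ring
        · refine ⟨(p.1 - a.1) / (b.1 - a.1), ?_⟩
          ext
          · simp; field_simp; ring
          · simp; field_simp; linarith
  rcases hcol.wbtw_or_wbtw_or_wbtw with h | h | h
  · right; left; exact mem_segment_iff_wbtw.mpr h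
  · right; right; rw [segment_symm]; exact mem_segment_iff_wbtw.mpr h
  · left; rw [segment_symm]; exact mem_segment_iff_wbtw.mpr h

/-- Four points in general position: crossing or one inside. -/
lemma four_points {x y z w : ℝ × ℝ} (h0 : orD x y z ≠ 0) (h1 : orD w y z ≠ 0)
    (h2 : orD x w z ≠ 0) (h3 : orD x y w ≠ 0) :
    Ins x y z w ∨ Ins w y z x ∨ Ins w x z y ∨ Ins w x y z ∨
    (segment ℝ w x ∩ segment ℝ y z).Nonempty ∨ (segment ℝ w y ∩ segment ℝ x z).Nonempty ∨
    (segment ℝ w z ∩ segment ℝ x y).Nonempty := by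
  have hS : orD w y z + orD x w z + orD x y w = orD x y z := by simp only [orD]; ring
  have hX : orD x y z * w.1 = orD w y z * x.1 + orD x w z * y.1 + orD x y w * z.1 := by
    simp only [orD]; ring
  have hY : orD x y z * w.2 = orD w y z * x.2 + orD x w z * y.2 + orD x y w * z.2 := by
    simp only [orD]; ring
  have e1 : orD w x z = - orD x w z := by simp only [orD]; ring
  have e2 : orD w x y = orD x y w := by simp only [orD]; ring
  have e3 : orD y x z = - orD x y z := by simp only [orD]; ring
  have e4 : orD w y x = - orD x y w := by simp only [orD]; ring
  have e5 : orD z x y = orD x y z := by simp only [orD]; ring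
  have e6 : orD w z y = - orD w y z := by simp only [orD]; ring
  simp only [Ins, e1, e2, e3, e4, e5, e6]
  generalize orD x y z = D at *
  generalize orD w y z = A at *
  generalize orD x w z = B at *
  generalize orD x y w = C at *
  -- crossing criterion
  have key : ∀ {p q r s : ℝ × ℝ} {a b c d : ℝ}, 0 ≤ a → 0 ≤ b → 0 ≤ c → 0 ≤ d → 0 < a + b →
      a + b = c + d → a * p.1 + b * q.1 = c * r.1 + d * s.1 →
      a * p.2 + b * q.2 = c * r.2 + d * s.2 →
      (segment ℝ p q ∩ segment ℝ r s).Nonempty := by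
    intro p q r s a b c d ha hb hc hd hab e f1 f2
    have hcd : 0 < c + d := e ▸ hab
    refine ⟨((a * p.1 + b * q.1) / (a + b), (a * p.2 + b * q.2) / (a + b)),
      mem_seg_of (x := a / (a + b)) (y := b / (a + b)) (by positivity) (by positivity) ?_ ?_ ?_,
      mem_seg_of (x := c / (a + b)) (y := d / (a + b)) (by positivity) (by positivity) ?_ ?_ ?_⟩
    · field_simp
    · simp; ring
    · simp; ring
    · field_simp; linarith
    · simp only [f1]; ring
    · simp only [f2]; ring
  have sgn : ∀ v : ℝ, v ≠ 0 → v < 0 ∨ 0 < v := fun v hv => lt_or_gt_of_ne hv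
  rcases sgn D h0 with d | d <;> rcases sgn A h1 with a | a <;> rcases sgn B h2 with b | b <;>
    rcases sgn C h3 with c | c
  · left; exact ⟨mul_pos_of_neg_of_neg d a, mul_pos_of_neg_of_neg d b, mul_pos_of_neg_of_neg d c⟩
  · right; right; right; right; right; right
    exact key (a := -D) (b := C) (c := -A) (d := -B) (by linarith) (by linarith) (by linarith)
      (by linarith) (by linarith) (by linarith) (by linarith) (by linarith)
  · right; right; right; right; right; left
    exact key (a := -D) (b := B) (c := -A) (d := -C) (by linarith) (by linarith) (by linarith)
      (by linarith) (by linarith) (by linarith) (by linarith) (by linarith)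
  · right; left
    refine ⟨?_, ?_, ?_⟩ <;> nlinarith
  · right; right; right; right; left
    exact key (a := -D) (b := A) (c := -B) (d := -C) (by linarith) (by linarith) (by linarith)
      (by linarith) (by linarith) (by linarith) (by linarith) (by linarith)
  · right; right; left
    refine ⟨?_, ?_, ?_⟩ <;> nlinarith
  · right; right; right; left
    refine ⟨?_, ?_, ?_⟩ <;> nlinarith
  · exfalso; linarith
  · exfalso; linarith
  · right; right; right; left
    refine ⟨?_, ?_, ?_⟩ <;> nlinarith
  · right; right; left
    refine ⟨?_, ?_, ?_⟩ <;> nlinarith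
  · right; right; right; right; left
    exact key (a := D) (b := -A) (c := B) (d := C) (by linarith) (by linarith) (by linarith)
      (by linarith) (by linarith) (by linarith) (by linarith) (by linarith)
  · right; left
    refine ⟨?_, ?_, ?_⟩ <;> nlinarith
  · right; right; right; right; right; left
    exact key (a := D) (b := -B) (c := A) (d := C) (by linarith) (by linarith) (by linarith)
      (by linarith) (by linarith) (by linarith) (by linarith) (by linarith)
  · right; right; right; right; right; right
    exact key (a := D) (b := -C) (c := A) (d := B) (by linarith) (by linarith) (by linarith)
      (by linarith) (by linarith) (by linarith) (by linarith) (by linarith)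
  · left; exact ⟨mul_pos d a, mul_pos d b, mul_pos d c⟩

lemma ray_mem {m x z p : ℝ × ℝ} (hb : 0 < orD m z x) (hX : orD m x p = 0) (hZ : 0 ≤ orD m z p)
    (h : 0 < orD x p z) : p ∈ segment ℝ m x := by
  have e : orD x p z = orD m z x - orD m z p + orD m x p := by simp only [orD]; ring
  have f1 : orD m z x * p.1 = orD m z x * m.1 + orD m z p * (x.1 - m.1)
      - orD m x p * (z.1 - m.1) := by simp only [orD]; ring
  have f2 : orD m z x * p.2 = orD m z x * m.2 + orD m z p * (x.2 - m.2)
      - orD m x p * (z.2 - m.2) := by simp only [orD]; ring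
  rw [hX] at e f1 f2
  generalize orD m z x = b at *
  generalize orD m z p = Z at *
  refine mem_seg_of (x := (b - Z) / b) (y := Z / b) ?_ (by positivity) ?_ ?_ ?_
  · apply div_nonneg <;> linarith
  · field_simp; ring
  · field_simp; linarith
  · field_simp; linarith

/-- Location of a point in the three subtriangles, positively oriented case. -/
lemma sub_loc_pos {x y z m p : ℝ × ℝ} (hD : 0 < orD x y z) (hm : Ins x y z m) (hp : Ins x y z p)
    (n1 : p ∉ segment ℝ m x) (n2 : p ∉ segment ℝ m y) (n3 : p ∉ segment ℝ m z) :
    Ins m x y p ∨ Ins m y z p ∨ Ins m x z p := by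
  obtain ⟨m1, m2, m3⟩ := hm
  obtain ⟨p1, p2, p3⟩ := hp
  replace m1 := (mul_pos_iff_of_pos_left hD).mp m1
  replace m2 := (mul_pos_iff_of_pos_left hD).mp m2
  replace m3 := (mul_pos_iff_of_pos_left hD).mp m3
  replace p1 := (mul_pos_iff_of_pos_left hD).mp p1
  replace p2 := (mul_pos_iff_of_pos_left hD).mp p2
  replace p3 := (mul_pos_iff_of_pos_left hD).mp p3
  have rel : orD m y z * orD m x p + orD x m z * orD m y p + orD x y m * orD m z p = 0 := by
    simp only [orD]; ring
  have b1 : 0 < orD m z x := by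
    have : orD m z x = orD x m z := by simp only [orD]; ring
    rwa [this]
  have b2 : 0 < orD m x y := by
    have : orD m x y = orD x y m := by simp only [orD]; ring
    rwa [this]
  have q2 : 0 < orD y p x := by
    have : orD y p x = orD x y p := by simp only [orD]; ring
    rwa [this]
  have q3 : 0 < orD z p y := by
    have : orD z p y = orD p y z := by simp only [orD]; ring
    rwa [this]
  have r1 : orD m x p = 0 → 0 ≤ orD m z p → False := fun h h' => n1 (ray_mem b1 h h' p2)
  have r2 : orD m y p = 0 → 0 ≤ orD m x p → False := fun h h' => n2 (ray_mem b2 h h' q2)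
  have r3 : orD m z p = 0 → 0 ≤ orD m y p → False := fun h h' => n3 (ray_mem m1 h h' q3)
  have c1 : 0 < orD m x p → orD m y p < 0 → Ins m x y p := fun h h' => by
    have e1 : orD m x y = orD x y m := by simp only [orD]; ring
    have e2 : orD p x y = orD x y p := by simp only [orD]; ring
    have e3 : orD m p y = - orD m y p := by simp only [orD]; ring
    refine ⟨?_, ?_, ?_⟩ <;> simp only [e1, e2, e3] <;> apply mul_pos <;> linarith
  have c2 : 0 < orD m y p → orD m z p < 0 → Ins m y z p := fun h h' => by
    have e3 : orD m p z = - orD m z p := by simp only [orD]; ring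
    refine ⟨?_, ?_, ?_⟩ <;> (try simp only [e3]) <;> apply mul_pos <;> linarith
  have c3 : 0 < orD m z p → orD m x p < 0 → Ins m x z p := fun h h' => by
    have e1 : orD m x z = - orD x m z := by simp only [orD]; ring
    have e2 : orD p x z = - orD x p z := by simp only [orD]; ring
    have e3 : orD m p z = - orD m z p := by simp only [orD]; ring
    refine ⟨?_, ?_, ?_⟩ <;> simp only [e1, e2, e3] <;> apply mul_pos_of_neg_of_neg <;> linarith
  generalize orD m x p = X at *
  generalize orD m y p = Y at *
  generalize orD m z p = Z at *
  generalize orD m y z = a at *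
  generalize orD x m z = b at *
  generalize orD x y m = c at *
  have P1 : X ≤ 0 → Y ≤ 0 → Z ≤ 0 → X + Y + Z < 0 → False := by
    intro hX hY hZ h
    have k1 := mul_nonneg m1.le (neg_nonneg.mpr hX)
    have k2 := mul_nonneg m2.le (neg_nonneg.mpr hY)
    have k3 := mul_nonneg m3.le (neg_nonneg.mpr hZ)
    have z1 : X = 0 := (mul_eq_zero.mp (by linarith : a * X = 0)).resolve_left m1.ne'
    have z2 : Y = 0 := (mul_eq_zero.mp (by linarith : b * Y = 0)).resolve_left m2.ne'
    have z3 : Z = 0 := (mul_eq_zero.mp (by linarith : c * Z = 0)).resolve_left m3.ne'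
    linarith
  have P2 : 0 ≤ X → 0 ≤ Y → 0 ≤ Z → 0 < X + Y + Z → False := by
    intro hX hY hZ h
    have k1 := mul_nonneg m1.le hX
    have k2 := mul_nonneg m2.le hY
    have k3 := mul_nonneg m3.le hZ
    have z1 : X = 0 := (mul_eq_zero.mp (by linarith : a * X = 0)).resolve_left m1.ne'
    have z2 : Y = 0 := (mul_eq_zero.mp (by linarith : b * Y = 0)).resolve_left m2.ne'
    have z3 : Z = 0 := (mul_eq_zero.mp (by linarith : c * Z = 0)).resolve_left m3.ne'
    linarith
  rcases lt_trichotomy X 0 with hX | hX | hX <;> rcases lt_trichotomy Y 0 with hY | hY | hY <;>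
    rcases lt_trichotomy Z 0 with hZ | hZ | hZ <;>
    first
    | exact Or.inl (c1 hX hY)
    | exact Or.inr (Or.inl (c2 hY hZ))
    | exact Or.inr (Or.inr (c3 hZ hX))
    | exact (r1 hX hZ.le).elim
    | exact (r1 hX hZ.ge).elim
    | exact (r2 hY hX.le).elim
    | exact (r2 hY hX.ge).elim
    | exact (r3 hZ hY.le).elim
    | exact (r3 hZ hY.ge).elim
    | exact (P1 (by linarith) (by linarith) (by linarith) (by linarith)).elim
    | exact (P2 (by linarith) (by linarith) (by linarith) (by linarith)).elim

lemma Ins.ne_zero {a b c p : ℝ × ℝ} (h : Ins a b c p) : orD a b c ≠ 0 := by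
  intro h0
  have := h.1
  rw [h0] at this; simp at this

lemma sub_loc {x y z m p : ℝ × ℝ} (hm : Ins x y z m) (hp : Ins x y z p)
    (n1 : p ∉ segment ℝ m x) (n2 : p ∉ segment ℝ m y) (n3 : p ∉ segment ℝ m z) :
    Ins m x y p ∨ Ins m y z p ∨ Ins m x z p := by
  rcases lt_or_gt_of_ne hm.ne_zero with h | h
  · have h' : 0 < orD x z y := by
      have : orD x z y = - orD x y z := by simp only [orD]; ring
      linarith
    rcases sub_loc_pos h' hm.swap23 hp.swap23 n1 n3 n2 with h | h | h
    · exact Or.inr (Or.inr h)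
    · exact Or.inr (Or.inl h.swap23)
    · exact Or.inl h
  · exact sub_loc_pos h hm hp n1 n2 n3

/-- A corner of a triangle is not inside a subtriangle. -/
lemma not_ins_corner {x y z m : ℝ × ℝ} (hm : Ins x y z m) : ¬ Ins m x y z := by
  intro h
  obtain ⟨m1, m2, m3⟩ := hm
  obtain ⟨h1, h2, h3⟩ := h
  have e1 : orD m x y = orD x y m := by simp only [orD]; ring
  have e2 : orD m z y = - orD m y z := by simp only [orD]; ring
  rw [e1, e2] at h2
  have a := mul_pos m1 m3
  have b := mul_pos a h2
  nlinarith [sq_nonneg (orD x y z * orD m y z * orD x y m)]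

/-- The line through `m` and `x` separates `y` from `z`. -/
lemma sep_line {x y z m : ℝ × ℝ} (hm : Ins x y z m) : orD m x y * orD m x z < 0 := by
  obtain ⟨m1, m2, m3⟩ := hm
  have e1 : orD m x y = orD x y m := by simp only [orD]; ring
  have e2 : orD m x z = - orD x m z := by simp only [orD]; ring
  rw [e1, e2]
  have a := mul_pos m2 m3
  by_contra h
  push Not at h
  nlinarith [mul_nonneg (sq_nonneg (orD x y z)) h]

/-! ### Planar straight-line frames -/

section Frame
variable {V : Type*} {G : SimpleGraph V} {S : Set V} {D : V → ℝ × ℝ}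

lemma frame_not_mem_seg (hP : IsPlanarSLFrame G S D) {a b p : V} (hab : G.Adj a b)
    (ha : a ∈ S) (hb : b ∈ S) (hp : p ∈ S) (hpa : p ≠ a) (hpb : p ≠ b) :
    D p ∉ segment ℝ (D a) (D b) := by
  intro h
  have h1 : D a ≠ D p := fun h' => hpa (hP.1 hp ha h'.symm)
  have h2 : D b ≠ D p := fun h' => hpb (hP.1 hp hb h'.symm)
  exact hP.2.1 a b p hab ha hb hp hpa hpb (mem_openSegment_of_ne_left_right h1 h2 h)

/-- A triangle of the graph all of whose vertices are visible. -/
structure Tri (G : SimpleGraph V) (S : Set V) (a b c : V) : Prop where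
  ab : G.Adj a b
  bc : G.Adj b c
  ac : G.Adj a c
  ha : a ∈ S
  hb : b ∈ S
  hc : c ∈ S

lemma Tri.nondeg (hP : IsPlanarSLFrame G S D) {a b c : V} (h : Tri G S a b c) :
    orD (D a) (D b) (D c) ≠ 0 := by
  intro h0
  rcases collinear_cases h0 with h' | h' | h'
  · exact frame_not_mem_seg hP h.bc h.hb h.hc h.ha h.ab.ne h.ac.ne h'
  · exact frame_not_mem_seg hP h.ac h.ha h.hc h.hb h.ab.ne' h.bc.ne h'
  · exact frame_not_mem_seg hP h.ab h.ha h.hb h.hc h.ac.ne' h.bc.ne' h'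

lemma frame_disj (hP : IsPlanarSLFrame G S D) {a b p q : V} (hab : G.Adj a b) (hpq : G.Adj p q)
    (ha : a ∈ S) (hb : b ∈ S) (hp : p ∈ S) (hq : q ∈ S)
    (h1 : p ≠ a) (h2 : p ≠ b) (h3 : q ≠ a) (h4 : q ≠ b) (r : ℝ × ℝ)
    (hr : r ∈ segment ℝ (D p) (D q)) (hr' : r ∈ segment ℝ (D a) (D b)) : False := by
  obtain ⟨z, hz, hz', -⟩ := hP.2.2 p q a b hpq hab hp hq ha hb (by tauto) r ⟨hr, hr'⟩
  rcases hz with rfl | rfl <;> rcases hz' with rfl | rfl <;> tauto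

/-- An edge avoiding a triangle does not cross its boundary. -/
lemma Tri.transfer (hP : IsPlanarSLFrame G S D) {a b c p q : V} (h : Tri G S a b c)
    (hpq : G.Adj p q) (hp : p ∈ S) (hq : q ∈ S)
    (h1 : p ≠ a) (h2 : p ≠ b) (h3 : p ≠ c) (h4 : q ≠ a) (h5 : q ≠ b) (h6 : q ≠ c)
    (hin : Ins (D a) (D b) (D c) (D p)) : Ins (D a) (D b) (D c) (D q) := by
  by_contra hno
  obtain ⟨r, hr, h' | h' | h'⟩ := cross_boundary (h.nondeg hP) hin hno
  · exact frame_disj hP h.ab hpq h.ha h.hb hp hq h1 h2 h4 h5 r hr h'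
  · exact frame_disj hP h.bc hpq h.hb h.hc hp hq h2 h3 h5 h6 r hr h'
  · exact frame_disj hP h.ac hpq h.ha h.hc hp hq h1 h3 h4 h6 r hr h'

structure K4 (G : SimpleGraph V) (S : Set V) (x y z w : V) : Prop where
  t : Tri G S x y z
  xw : G.Adj x w
  yw : G.Adj y w
  zw : G.Adj z w
  hw : w ∈ S

lemma K4.inside (hP : IsPlanarSLFrame G S D) {x y z w : V} (h : K4 G S x y z w) :
    Ins (D x) (D y) (D z) (D w) ∨ Ins (D w) (D y) (D z) (D x) ∨ Ins (D w) (D x) (D z) (D y) ∨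
      Ins (D w) (D x) (D y) (D z) := by
  obtain ⟨⟨xy, yz, xz, hx, hy, hz⟩, xw, yw, zw, hw⟩ := h
  have t1 : Tri G S w y z := ⟨yw.symm, yz, zw.symm, hw, hy, hz⟩
  have t2 : Tri G S x w z := ⟨xw, zw.symm, xz, hx, hw, hz⟩
  have t3 : Tri G S x y w := ⟨xy, yw, xw, hx, hy, hw⟩
  have t0 : Tri G S x y z := ⟨xy, yz, xz, hx, hy, hz⟩
  rcases four_points (t0.nondeg hP) (t1.nondeg hP) (t2.nondeg hP) (t3.nondeg hP) with
    h | h | h | h | ⟨r, h, h'⟩ | ⟨r, h, h'⟩ | ⟨r, h, h'⟩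
  · exact Or.inl h
  · exact Or.inr (Or.inl h)
  · exact Or.inr (Or.inr (Or.inl h))
  · exact Or.inr (Or.inr (Or.inr h))
  · exact (frame_disj hP yz xw.symm hy hz hw hx yw.ne' zw.ne' xy.ne xz.ne r h h').elim
  · exact (frame_disj hP xz yw.symm hx hz hw hy xw.ne' zw.ne' xy.ne' yz.ne r h h').elim
  · exact (frame_disj hP xy zw.symm hx hy hw hz xw.ne' yw.ne' xz.ne' yz.ne' r h h').elim

/-- Location of a vertex inside an outer triangle with inner vertex `m`. -/
lemma K4.loc (hP : IsPlanarSLFrame G S D) {x y z m p : V} (h : K4 G S x y z m)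
    (hm : Ins (D x) (D y) (D z) (D m)) (hp : p ∈ S) (pm : p ≠ m) (px : p ≠ x) (py : p ≠ y)
    (pz : p ≠ z) (hin : Ins (D x) (D y) (D z) (D p)) :
    Ins (D m) (D x) (D y) (D p) ∨ Ins (D m) (D y) (D z) (D p) ∨ Ins (D m) (D x) (D z) (D p) :=
  sub_loc hm hin (frame_not_mem_seg hP h.xw.symm h.hw h.t.ha hp pm px)
    (frame_not_mem_seg hP h.yw.symm h.hw h.t.hb hp pm py)
    (frame_not_mem_seg hP h.zw.symm h.hw h.t.hc hp pm pz)

/-- A vertex in a subtriangle is not adjacent to the opposite corner. -/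
lemma K4.not_sub (hP : IsPlanarSLFrame G S D) {x y z m p : V} (h : K4 G S x y z m)
    (hm : Ins (D x) (D y) (D z) (D m)) (hp : p ∈ S) (pm : p ≠ m) (px : p ≠ x) (py : p ≠ y)
    (hpz : G.Adj p z) : ¬ Ins (D m) (D x) (D y) (D p) := by
  intro hin
  have t : Tri G S m x y := ⟨h.xw.symm, h.t.ab, h.yw.symm, h.hw, h.t.ha, h.t.hb⟩
  exact not_ins_corner hm (t.transfer hP hpz hp h.t.hc pm px py h.zw.ne h.t.ac.ne' h.t.bc.ne' hin)

lemma K4.rot {x y z w : V} (hK : K4 G S x y z w) : K4 G S y z x w :=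
  ⟨⟨hK.t.bc, hK.t.ac.symm, hK.t.ab.symm, hK.t.hb, hK.t.hc, hK.t.ha⟩, hK.yw, hK.zw, hK.xw, hK.hw⟩

lemma K4.swap {x y z w : V} (hK : K4 G S x y z w) : K4 G S x z y w :=
  ⟨⟨hK.t.ac, hK.t.bc.symm, hK.t.ab, hK.t.ha, hK.t.hc, hK.t.hb⟩, hK.xw, hK.zw, hK.yw, hK.hw⟩

lemma Ins.rot {a b c p : ℝ × ℝ} (h : Ins a b c p) : Ins b c a p := h.swap12.swap23

/-- A vertex adjacent to `m, x, y` lies in the triangle `m x y`. -/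
lemma K4.face (hP : IsPlanarSLFrame G S D) {x y z m p : V} (h : K4 G S x y z m)
    (hm : Ins (D x) (D y) (D z) (D m)) (hp : p ∈ S) (pm : G.Adj p m) (px : G.Adj p x)
    (py : G.Adj p y) (pz : p ≠ z) : Ins (D m) (D x) (D y) (D p) := by
  have hin := h.t.transfer hP pm.symm h.hw hp h.xw.ne' h.yw.ne' h.zw.ne' px.ne py.ne pz hm
  rcases h.loc hP hm hp pm.ne px.ne py.ne pz hin with h' | h' | h'
  · exact h'
  · exact (h.rot.not_sub hP hm.rot hp pm.ne py.ne pz px h').elim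
  · exact (h.swap.not_sub hP hm.swap23 hp pm.ne px.ne pz py h').elim

/-- Auxiliary case of the nonexistence of two outer vertices. -/
lemma no_two_aux (hP : IsPlanarSLFrame G S D) {x y z b b' : V} (h : K4 G S x y z b)
    (hb' : b' ∈ S) (hx : G.Adj b' x) (hy : G.Adj b' y) (hz : G.Adj b' z) (hne : b' ≠ b)
    (n' : ¬ Ins (D x) (D y) (D z) (D b')) : ¬ Ins (D b) (D y) (D z) (D x) := by
  intro hin
  have K : K4 G S b y z x :=
    ⟨⟨h.yw.symm, h.t.bc, h.zw.symm, h.hw, h.t.hb, h.t.hc⟩, h.xw.symm, h.t.ab.symm, h.t.ac.symm,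
      h.t.ha⟩
  have := K.t.transfer hP hx.symm h.t.ha hb' h.xw.ne h.t.ab.ne h.t.ac.ne hne hy.ne hz.ne hin
  rcases K.loc hP hin hb' hx.ne hne hy.ne hz.ne this with h' | h' | h'
  · exact K.not_sub hP hin hb' hx.ne hne hy.ne hz h'
  · exact n' h'
  · exact K.swap.not_sub hP hin.swap23 hb' hx.ne hne hz.ne hy h'

lemma no_two_out (hP : IsPlanarSLFrame G S D) {x y z b b' : V} (h : K4 G S x y z b)
    (hb' : b' ∈ S) (hx : G.Adj b' x) (hy : G.Adj b' y) (hz : G.Adj b' z) (hne : b' ≠ b)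
    (n : ¬ Ins (D x) (D y) (D z) (D b)) (n' : ¬ Ins (D x) (D y) (D z) (D b')) : False := by
  rcases h.inside hP with h' | h' | h' | h'
  · exact n h'
  · exact no_two_aux hP h hb' hx hy hz hne n' h'
  · exact no_two_aux hP h.rot hb' hy hz hx hne (fun k => n' k.rot.rot) h'.swap23
  · exact no_two_aux hP h.rot.rot hb' hz hx hy hne (fun k => n' k.rot) h'

lemma no_two_in (hP : IsPlanarSLFrame G S D) {x y z b b' : V} (h : K4 G S x y z b)
    (hb' : b' ∈ S) (hx : G.Adj b' x) (hy : G.Adj b' y) (hz : G.Adj b' z) (hne : b' ≠ b)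
    (n : Ins (D x) (D y) (D z) (D b)) (n' : Ins (D x) (D y) (D z) (D b')) : False := by
  rcases h.loc hP n hb' hne hx.ne hy.ne hz.ne n' with h' | h' | h'
  · exact h.not_sub hP n hb' hne hx.ne hy.ne hz h'
  · exact h.rot.not_sub hP n.rot hb' hne hy.ne hz.ne hx h'
  · exact h.swap.not_sub hP n.swap23 hb' hne hx.ne hz.ne hy h'

lemma no_three (hP : IsPlanarSLFrame G S D) {x y z : V} (h : Tri G S x y z) {ι : Type*}
    {b : ι → V} (hb : Function.Injective b) (hx : ∀ i, G.Adj (b i) x) (hy : ∀ i, G.Adj (b i) y)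
    (hz : ∀ i, G.Adj (b i) z) {i j k : ι} (hij : i ≠ j) (hik : i ≠ k) (hjk : j ≠ k)
    (hi : b i ∈ S) (hj : b j ∈ S) (hk : b k ∈ S) : False := by
  have K : ∀ l, b l ∈ S → K4 G S x y z (b l) := fun l hl =>
    ⟨h, (hx l).symm, (hy l).symm, (hz l).symm, hl⟩
  have I : ∀ l l', l ≠ l' → b l ∈ S → b l' ∈ S → Ins (D x) (D y) (D z) (D (b l)) →
      Ins (D x) (D y) (D z) (D (b l')) → False := fun l l' hne h1 h2 a a' =>
    no_two_in hP (K l h1) h2 (hx l') (hy l') (hz l') (hb.ne hne.symm) a a'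
  have O : ∀ l l', l ≠ l' → b l ∈ S → b l' ∈ S → ¬ Ins (D x) (D y) (D z) (D (b l)) →
      ¬ Ins (D x) (D y) (D z) (D (b l')) → False := fun l l' hne h1 h2 a a' =>
    no_two_out hP (K l h1) h2 (hx l') (hy l') (hz l') (hb.ne hne.symm) a a'
  have a1 := I i j hij hi hj
  have a2 := I i k hik hi hk
  have a3 := I j k hjk hj hk
  have b1 := O i j hij hi hj
  have b2 := O i k hik hi hk
  have b3 := O j k hjk hj hk
  tauto

end Frame

/-! ### Lifetimes in geometric storyplans -/

section Story
variable {V : Type*} {G : SimpleGraph V}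

/-- Among five vertices attached to a triangle, one lives only while the triangle is visible. -/
lemma exists_inner_life {len : ℕ} {s e : V → ℕ} {D : V → ℝ × ℝ}
    (hS : IsGeomStoryplan G len s e D) {x y z : V} (xy : G.Adj x y) (yz : G.Adj y z)
    (xz : G.Adj x z) {b : Fin 5 → V} (hb : Function.Injective b) (hx : ∀ i, G.Adj (b i) x)
    (hy : ∀ i, G.Adj (b i) y) (hz : ∀ i, G.Adj (b i) z) :
    ∃ i, (s x ≤ s (b i) ∧ e (b i) ≤ e x) ∧ (s y ≤ s (b i) ∧ e (b i) ≤ e y) ∧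
      (s z ≤ s (b i) ∧ e (b i) ≤ e z) := by
  obtain ⟨-, hlen, hadj, hfr⟩ := hS
  have A : ∀ {u v}, G.Adj u v → s u ≤ e v ∧ s v ≤ e u := by
    intro u v h
    obtain ⟨t, h1, h2, h3, h4⟩ := hadj u v h
    omega
  by_contra hcon
  push Not at hcon
  have Lx := hlen x
  have Ly := hlen y
  have Lz := hlen z
  have a1 := A xy
  have a2 := A yz
  have a3 := A xz
  let α := max (s x) (max (s y) (s z))
  let β := min (e x) (min (e y) (e z))
  have bad : ∀ τ, (s x ≤ τ ∧ τ ≤ e x) → (s y ≤ τ ∧ τ ≤ e y) → (s z ≤ τ ∧ τ ≤ e z) →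
      ∀ i j k, i ≠ j → i ≠ k → j ≠ k → (s (b i) ≤ τ ∧ τ ≤ e (b i)) →
      (s (b j) ≤ τ ∧ τ ≤ e (b j)) → (s (b k) ≤ τ ∧ τ ≤ e (b k)) → False := by
    intro τ h1 h2 h3 i j k hij hik hjk hi hj hk
    exact no_three (hfr τ (by omega) (by omega)) ⟨xy, yz, xz, h1, h2, h3⟩ hb hx hy hz
      hij hik hjk hi hj hk
  have badα := bad α (by omega) (by omega) (by omega)
  have badβ := bad β (by omega) (by omega) (by omega)
  have dich : ∀ i, (s (b i) ≤ α ∧ α ≤ e (b i)) ∨ (s (b i) ≤ β ∧ β ≤ e (b i)) := by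
    intro i
    have b1 := A (hx i)
    have b2 := A (hy i)
    have b3 := A (hz i)
    have b4 := hlen (b i)
    have := hcon i
    omega
  clear_value α β
  classical
  let f : Fin 5 → Bool := fun i => decide (s (b i) ≤ α ∧ α ≤ e (b i))
  obtain ⟨y, hy⟩ := Fintype.exists_lt_card_fiber_of_mul_lt_card (f := f) (n := 2) (by simp)
  obtain ⟨i, j, k, hi, hj, hk, hij, hik, hjk⟩ := Finset.two_lt_card_iff.mp hy
  simp only [Finset.mem_filter, Finset.mem_univ, true_and] at hi hj hk
  cases y
  · simp only [f, decide_eq_false_iff_not] at hi hj hk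
    exact badβ i j k hij hik hjk ((dich i).resolve_left hi) ((dich j).resolve_left hj)
      ((dich k).resolve_left hk)
  · simp only [f, decide_eq_true_eq] at hi hj hk
    exact badα i j k hij hik hjk hi hj hk

end Story

/-! ### The graph -/

/-- Colourings of the twelve ground vertices by three colours. -/
abbrev Col : Type := Fin 3 × Fin 4 → Fin 3

/-- Vertices: twelve ground vertices `f`; for each colouring a gadget with vertices `t, u, s`. -/
inductive GV : Type
  | f (j : Fin 3 × Fin 4) : GV
  | t (c : Col) (i : Fin 3) : GV
  | u (c : Col) (k : Fin 5) : GV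
  | s (c : Col) (k : Fin 5) (i : Fin 3) (l : Fin 5) : GV

/-- Adjacency of the graph. -/
def gAdj : GV → GV → Prop
  | .f j, .s c _ i _ => c j = i
  | .s c _ i _, .f j => c j = i
  | .t c i, .t c' i' => c = c' ∧ i ≠ i'
  | .t c _, .u c' _ => c = c'
  | .u c _, .t c' _ => c = c'
  | .t c i, .s c' _ i' _ => c = c' ∧ i ≠ i'
  | .s c _ i _, .t c' i' => c = c' ∧ i ≠ i'
  | .u c k, .s c' k' _ _ => c = c' ∧ k = k'
  | .s c k _ _, .u c' k' => c = c' ∧ k = k'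
  | _, _ => False

/-- The graph separating planar storyplans from planar geometric storyplans. -/
def GG : SimpleGraph GV where
  Adj := gAdj
  symm := by
    constructor
    rintro (_ | _ | _ | _) (_ | _ | _ | _) h <;> simp only [gAdj] at h ⊢ <;>
      first
      | exact h
      | exact h.symm
      | exact ⟨h.1.symm, h.2.symm⟩
  loopless := by
    constructor
    rintro (_ | _ | _ | _) h <;> simp [gAdj] at h

lemma convex_side (a b : ℝ × ℝ) (w : ℝ) : Convex ℝ {p | 0 < w * orD a b p} := by
  intro x hx y hy α β hα hβ hαβ
  simp only [Set.mem_ofPred_eq] at hx hy ⊢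
  have e : w * orD a b (α • x + β • y) = α * (w * orD a b x) + β * (w * orD a b y) := by
    have hβ' : β = 1 - α := by linarith
    subst hβ'
    simp only [orD, Prod.fst_add, Prod.snd_add, Prod.smul_fst, Prod.smul_snd, smul_eq_mul]
    ring
  rw [e]
  rcases hα.eq_or_lt with h | h
  · have : β = 1 := by linarith
    rw [← h, this]; linarith
  · have := mul_pos h hx
    have := mul_nonneg hβ hy.le
    linarith

lemma radon_four (P : Fin 4 → ℝ × ℝ) :
    ∃ I : Set (Fin 4), (convexHull ℝ (P '' I) ∩ convexHull ℝ (P '' Iᶜ)).Nonempty := by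
  apply Convex.radon_partition (𝕜 := ℝ)
  intro h
  have := h.card_le_finrank_succ
  have h2 : Module.finrank ℝ (vectorSpan ℝ (Set.range P)) ≤ Module.finrank ℝ (ℝ × ℝ) :=
    Submodule.finrank_le _
  simp at this h2
  omega

theorem not_geom : ¬ HasGeomStoryplan GG := by
  classical
  rintro ⟨len, s, e, D, hS⟩
  choose I hI using fun g : Fin 3 => radon_four (fun a => D (GV.f (g, a)))
  let c : Col := fun p => if p.2 ∈ I p.1 then p.1 + 1 else p.1 + 2
  have tt : ∀ i j, i ≠ j → GG.Adj (.t c i) (.t c j) := fun i j h => ⟨rfl, h⟩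
  obtain ⟨k, hk⟩ := exists_inner_life hS (tt 0 1 (by decide)) (tt 1 2 (by decide))
    (tt 0 2 (by decide)) (b := GV.u c) (fun a b h => by simpa using h) (fun _ => rfl)
    (fun _ => rfl) (fun _ => rfl)
  have hlt : ∀ i, s (.t c i) ≤ s (.u c k) ∧ e (.u c k) ≤ e (.t c i) := by
    intro i; fin_cases i
    · exact hk.1
    · exact hk.2.1
    · exact hk.2.2
  have ut : ∀ i, GG.Adj (.u c k) (.t c i) := fun i => rfl
  have st : ∀ i j l, i ≠ j → GG.Adj (.s c k i l) (.t c j) := fun i j l h => ⟨rfl, h⟩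
  have su : ∀ i l, GG.Adj (.s c k i l) (.u c k) := fun i l => ⟨rfl, rfl⟩
  have hl : ∀ i : Fin 3, ∃ l, s (.u c k) ≤ s (.s c k i l) ∧ e (.s c k i l) ≤ e (.u c k) := by
    intro i
    obtain ⟨l, hl⟩ := exists_inner_life hS (ut (i + 1)) (tt (i + 1) (i + 2) (by clear * -; decide +revert))
      (ut (i + 2)) (b := GV.s c k i) (fun a b h => by simpa using h) (fun l => su i l)
      (fun l => st i _ l (by clear * -; decide +revert)) (fun l => st i _ l (by clear * -; decide +revert))
    exact ⟨l, hl.1⟩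
  choose l hl using hl
  obtain ⟨-, hlen, hadj, hfr⟩ := hS
  -- all frames during the life of `u` contain the complete graph
  have hK : ∀ τ, s (.u c k) ≤ τ → τ ≤ e (.u c k) → ∀ a : Fin 3,
      K4 GG {v | s v ≤ τ ∧ τ ≤ e v} (.t c a) (.t c (a + 1)) (.t c (a + 2)) (.u c k) := by
    intro τ h1 h2 a
    have V : ∀ i, s (.t c i) ≤ τ ∧ τ ≤ e (.t c i) := fun i => by have := hlt i; omega
    exact ⟨⟨tt _ _ (by clear * -; decide +revert), tt _ _ (by clear * -; decide +revert),
      tt _ _ (by clear * -; decide +revert), V _, V _, V _⟩, rfl, rfl, rfl, h1, h2⟩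
  have hK' : ∀ τ, s (.u c k) ≤ τ → τ ≤ e (.u c k) → ∀ a : Fin 3,
      K4 GG {v | s v ≤ τ ∧ τ ≤ e v} (.u c k) (.t c (a + 1)) (.t c (a + 2)) (.t c a) := by
    intro τ h1 h2 a
    have K := hK τ h1 h2 a
    exact ⟨⟨K.yw.symm, K.t.bc, K.zw.symm, K.hw, K.t.hb, K.t.hc⟩, K.xw.symm, K.t.ab.symm,
      K.t.ac.symm, K.t.ha⟩
  have main : ∀ a : Fin 3,
      (Ins (D (.t c a)) (D (.t c (a + 1))) (D (.t c (a + 2))) (D (.u c k)) ∨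
        Ins (D (.u c k)) (D (.t c (a + 1))) (D (.t c (a + 2))) (D (.t c a))) → False := by
    intro a hcase
    have loc1 : ∀ j, c j = a + 1 →
        Ins (D (.u c k)) (D (.t c a)) (D (.t c (a + 2))) (D (.f j)) := by
      intro j hj
      have fs : GG.Adj (.s c k (a + 1) (l (a + 1))) (.f j) := hj
      obtain ⟨τ, h1, h2, h3, h4⟩ := hadj _ _ fs
      have hla := hl (a + 1)
      have hu := hlen (.u c k)
      have P := hfr τ (by omega) (by omega)
      have K := hK τ (by omega) (by omega) a
      have K' := hK' τ (by omega) (by omega) a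
      have hin : Ins (D (.u c k)) (D (.t c a)) (D (.t c (a + 2)))
          (D (.s c k (a + 1) (l (a + 1)))) := by
        rcases hcase with h | h
        · exact K.swap.face P h.swap23 ⟨h1, h2⟩ (su _ _) (st _ _ _ (by clear * -; decide +revert))
            (st _ _ _ (by clear * -; decide +revert)) (by simp)
        · exact (K'.swap.face P h.swap23 ⟨h1, h2⟩ (st _ _ _ (by clear * -; decide +revert)) (su _ _)
            (st _ _ _ (by clear * -; decide +revert)) (by simp)).swap12
      have T : Tri GG {v | s v ≤ τ ∧ τ ≤ e v} (.u c k) (.t c a) (.t c (a + 2)) :=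
        ⟨ut _, K.t.ac, ut _, K.hw, K.t.ha, K.t.hc⟩
      exact T.transfer P fs ⟨h1, h2⟩ ⟨h3, h4⟩ (by simp) (by simp) (by simp) (by simp) (by simp)
        (by simp) hin
    have loc2 : ∀ j, c j = a + 2 →
        Ins (D (.u c k)) (D (.t c a)) (D (.t c (a + 1))) (D (.f j)) := by
      intro j hj
      have fs : GG.Adj (.s c k (a + 2) (l (a + 2))) (.f j) := hj
      obtain ⟨τ, h1, h2, h3, h4⟩ := hadj _ _ fs
      have hla := hl (a + 2)
      have hu := hlen (.u c k)
      have P := hfr τ (by omega) (by omega)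
      have K := hK τ (by omega) (by omega) a
      have K' := hK' τ (by omega) (by omega) a
      have hin : Ins (D (.u c k)) (D (.t c a)) (D (.t c (a + 1)))
          (D (.s c k (a + 2) (l (a + 2)))) := by
        rcases hcase with h | h
        · exact K.face P h ⟨h1, h2⟩ (su _ _) (st _ _ _ (by clear * -; decide +revert))
            (st _ _ _ (by clear * -; decide +revert)) (by simp)
        · exact (K'.face P h ⟨h1, h2⟩ (st _ _ _ (by clear * -; decide +revert)) (su _ _)
            (st _ _ _ (by clear * -; decide +revert)) (by simp)).swap12
      have T : Tri GG {v | s v ≤ τ ∧ τ ≤ e v} (.u c k) (.t c a) (.t c (a + 1)) :=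
        ⟨ut _, K.t.ab, ut _, K.hw, K.t.ha, K.t.hb⟩
      exact T.transfer P fs ⟨h1, h2⟩ ⟨h3, h4⟩ (by simp) (by simp) (by simp) (by simp) (by simp)
        (by simp) hin
    have sep : orD (D (.u c k)) (D (.t c a)) (D (.t c (a + 1))) *
        orD (D (.u c k)) (D (.t c a)) (D (.t c (a + 2))) < 0 := by
      rcases hcase with h | h
      · exact sep_line h
      · have := sep_line h
        have e : ∀ q, orD (D (.t c a)) (D (.u c k)) q = - orD (D (.u c k)) (D (.t c a)) q := by
          intro q; simp only [orD]; ring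
        rw [e, e] at this
        linarith
    obtain ⟨r, hr1, hr2⟩ := hI a
    have m1 := convexHull_min (t := {p | 0 < orD (D (.u c k)) (D (.t c a)) (D (.t c (a + 2))) *
        orD (D (.u c k)) (D (.t c a)) p}) (by
      rintro _ ⟨b, hb, rfl⟩
      exact (loc1 (a, b) (by simp [c, hb])).2.2) (convex_side _ _ _) hr1
    have m2 := convexHull_min (t := {p | 0 < orD (D (.u c k)) (D (.t c a)) (D (.t c (a + 1))) *
        orD (D (.u c k)) (D (.t c a)) p}) (by
      rintro _ ⟨b, hb, rfl⟩
      have hb' : b ∉ I a := hb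
      exact (loc2 (a, b) (by simp [c, hb'])).2.2) (convex_side _ _ _) hr2
    simp only [Set.mem_ofPred_eq] at m1 m2
    nlinarith [mul_pos m1 m2, sq_nonneg (orD (D (.u c k)) (D (.t c a)) r)]
  have hu := hlen (.u c k)
  have K := hK (s (.u c k)) le_rfl hu.2.1 0
  have P := hfr (s (.u c k)) (by omega) (by omega)
  rcases K.inside P with h | h | h | h
  · exact main 0 (Or.inl h)
  · exact main 0 (Or.inr h)
  · exact main 1 (Or.inr h.swap23)
  · exact main 2 (Or.inr h)

/-! ### A planar storyplan: virtual straight-line drawing -/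

/-- Virtual positions of the `t`-vertices. -/
def tP (i : Fin 3) : ℤ × ℤ := if i = 0 then (354, 363) else if i = 1 then (352, -358) else (-115, -2)

/-- Virtual position of the `u`-vertices. -/
def uP : ℤ × ℤ := (-12, 3)

/-- Virtual positions of the `s`-vertices. -/
def sP (i : Fin 3) : ℤ × ℤ := if i = 0 then (-9, -69) else if i = 1 then (-12, 72) else (35, 6)

/-- Height of the virtual row of colour `q`. -/
def rowY (q : Fin 3) : ℤ := if q = 0 then -40 else if q = 1 then 47 else 4

/-- Abscissa of a ground vertex. -/
def colX (j : Fin 3 × Fin 4) : ℤ := 4 * (j.1.val : ℤ) + (j.2.val : ℤ)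

/-- Virtual position of a ground vertex of colour `q`. -/
def fP (j : Fin 3 × Fin 4) (q : Fin 3) : ℤ × ℤ := (colX j, rowY q)

/-- All ground indices. -/
def allJ : List (Fin 3 × Fin 4) := (List.finRange 3) ×ˢ (List.finRange 4)

/-- All virtual points. -/
def vPts : List (ℤ × ℤ) :=
  uP :: ((List.finRange 3).map tP ++ (List.finRange 3).map sP ++
    allJ.flatMap fun j => (List.finRange 3).map fun q => fP j q)

/-- All virtual edges, in one orientation. -/
def vEdges : List ((ℤ × ℤ) × (ℤ × ℤ)) :=
  [(tP 0, tP 1), (tP 0, tP 2), (tP 1, tP 2)] ++ (List.finRange 3).map (fun i => (uP, tP i)) ++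
  (List.finRange 3).map (fun i => (uP, sP i)) ++
  [(sP 0, tP 1), (sP 0, tP 2), (sP 1, tP 0), (sP 1, tP 2), (sP 2, tP 0), (sP 2, tP 1)] ++
  allJ.flatMap fun j => (List.finRange 3).map fun q => (sP q, fP j q)

/-- Integer orientation determinant. -/
def detZ (a b c : ℤ × ℤ) : ℤ := (b.1 - a.1) * (c.2 - a.2) - (b.2 - a.2) * (c.1 - a.1)

/-- The two integers have the same nonzero sign. -/
def sameZ (x y : ℤ) : Bool := decide (0 < x * y)

set_option maxRecDepth 100000 in
lemma check_one : (vEdges.all fun e => !decide (e.1 = e.2) && vPts.all fun w =>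
    decide (w = e.1) || decide (w = e.2) || !decide (detZ e.1 e.2 w = 0)) = true := by
  decide +kernel

set_option maxRecDepth 100000 in
lemma check_two : (vEdges.all fun e => vEdges.all fun e' =>
    decide (e.1 = e'.1) || decide (e.1 = e'.2) || decide (e.2 = e'.1) || decide (e.2 = e'.2) ||
    sameZ (detZ e.1 e.2 e'.1) (detZ e.1 e.2 e'.2) ||
    sameZ (detZ e'.1 e'.2 e.1) (detZ e'.1 e'.2 e.2)) = true := by
  decide +kernel

set_option maxRecDepth 100000 in
lemma mem_facts : (∀ i, tP i ∈ vPts) ∧ uP ∈ vPts ∧ (∀ i, sP i ∈ vPts) ∧ ∀ j q, fP j q ∈ vPts := by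
  decide +kernel

/-- Being joined by a virtual edge. -/
def vE (a b : ℤ × ℤ) : Prop := (a, b) ∈ vEdges ∨ (b, a) ∈ vEdges

instance (a b : ℤ × ℤ) : Decidable (vE a b) := by unfold vE; infer_instance

lemma vE.symm {a b : ℤ × ℤ} (h : vE a b) : vE b a := Or.symm h

set_option maxRecDepth 100000 in
lemma edge_facts : (∀ i j, i ≠ j → vE (tP i) (tP j)) ∧ (∀ i, vE uP (tP i)) ∧
    (∀ i, vE uP (sP i)) ∧ (∀ i j, i ≠ j → vE (sP i) (tP j)) ∧ ∀ j q, vE (sP q) (fP j q) := by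
  decide +kernel

set_option maxRecDepth 100000 in
lemma inj_facts : (∀ i j, tP i = tP j → i = j) ∧ (∀ i j, sP i = sP j → i = j) ∧
    (∀ i, tP i ≠ uP) ∧ (∀ i, sP i ≠ uP) ∧ (∀ i j, sP i ≠ tP j) ∧ (∀ j q, fP j q ≠ uP) ∧
    (∀ j q i, fP j q ≠ tP i) ∧ ∀ j q i, fP j q ≠ sP i := by
  decide +kernel

lemma colX_inj : ∀ i j, colX i = colX j → i = j := by
  decide +kernel

lemma vE.ne {a b : ℤ × ℤ} (h : vE a b) : a ≠ b := by
  have := check_one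
  rw [List.all_eq_true] at this
  rcases h with h | h
  · have := this _ h
    simp only [Bool.and_eq_true] at this
    simpa using this.1
  · have := this _ h
    simp only [Bool.and_eq_true] at this
    exact (by simpa using this.1 : b ≠ a).symm

lemma detZ_swap (a b c : ℤ × ℤ) : detZ b a c = - detZ a b c := by
  simp only [detZ]; ring

lemma vE.det {a b w : ℤ × ℤ} (h : vE a b) (hw : w ∈ vPts) (h1 : w ≠ a) (h2 : w ≠ b) :
    detZ a b w ≠ 0 := by
  have := check_one
  rw [List.all_eq_true] at this
  rcases h with h | h
  · have := this _ h
    rw [Bool.and_eq_true, List.all_eq_true] at this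
    simpa [h1, h2] using this.2 w hw
  · have := this _ h
    rw [Bool.and_eq_true, List.all_eq_true] at this
    have := this.2 w hw
    rw [detZ_swap]
    simpa [h1, h2] using this

lemma vE.cross {a b c d : ℤ × ℤ} (h : vE a b) (h' : vE c d) (h1 : a ≠ c) (h2 : a ≠ d)
    (h3 : b ≠ c) (h4 : b ≠ d) :
    0 < detZ a b c * detZ a b d ∨ 0 < detZ c d a * detZ c d b := by
  have := check_two
  simp only [List.all_eq_true] at this
  rcases h with h | h <;> rcases h' with h' | h'
  · simpa [h1, h2, h3, h4, sameZ] using this _ h _ h'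
  · have := this _ h _ h'
    rw [detZ_swap d c a, detZ_swap d c b, mul_comm (detZ a b c), neg_mul_neg] at *
    simpa [h1, h2, h3, h4, sameZ, detZ_swap d c] using this
  · have := this _ h _ h'
    have e : detZ c d a * detZ c d b = detZ c d b * detZ c d a := mul_comm _ _
    rw [e]
    simpa [h1, h2, h3, h4, sameZ, detZ_swap a b] using this
  · have := this _ h _ h'
    have e : detZ c d a * detZ c d b = detZ c d b * detZ c d a := mul_comm _ _
    have e2 : detZ a b c * detZ a b d = detZ a b d * detZ a b c := mul_comm _ _
    rw [e, e2]
    simpa [h1, h2, h3, h4, sameZ, detZ_swap a b, detZ_swap c d] using this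

/-- Integer points as real points. -/
def rho (p : ℤ × ℤ) : ℝ × ℝ := ((p.1 : ℝ), (p.2 : ℝ))

lemma orD_rho (a b c : ℤ × ℤ) : orD (rho a) (rho b) (rho c) = (detZ a b c : ℝ) := by
  simp [orD, rho, detZ]

lemma orD_line (a b c d : ℝ × ℝ) (r : ℝ) :
    orD a b (AffineMap.lineMap c d r) = (1 - r) * orD a b c + r * orD a b d := by
  simp only [orD, AffineMap.lineMap_apply, vsub_eq_sub, vadd_eq_add, Prod.fst_add, Prod.snd_add,
    Prod.smul_fst, Prod.smul_snd, Prod.fst_sub, Prod.snd_sub, smul_eq_mul]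
  ring

lemma orD_self_left (a b : ℝ × ℝ) : orD a b a = 0 := by simp only [orD]; ring

lemma orD_self_right (a b : ℝ × ℝ) : orD a b b = 0 := by simp only [orD]; ring

lemma orD_on_line (a b : ℝ × ℝ) (r : ℝ) : orD a b (AffineMap.lineMap a b r) = 0 := by
  rw [orD_line, orD_self_left, orD_self_right]; ring

lemma not_same_side {a b c d : ℝ × ℝ} {r r' : ℝ} (h0 : 0 ≤ r') (h1 : r' ≤ 1)
    (h : AffineMap.lineMap a b r = (AffineMap.lineMap c d r' : ℝ × ℝ)) :
    ¬ 0 < orD a b c * orD a b d := by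
  intro hs
  have e := orD_line a b c d r'
  rw [← h, orD_on_line] at e
  rcases pos_and_pos_or_neg_and_neg_of_mul_pos hs with ⟨p, q⟩ | ⟨p, q⟩ <;>
  · rcases h0.eq_or_lt with h2 | h2
    · subst h2; linarith
    · nlinarith

lemma rho_inj {a b : ℤ × ℤ} (h : rho a = rho b) : a = b := by
  simp only [rho, Prod.mk.injEq, Int.cast_inj] at h
  exact Prod.ext h.1 h.2

lemma vE.vertex {a b w : ℤ × ℤ} (h : vE a b) (hw : w ∈ vPts) {r : ℝ}
    (e : rho w = AffineMap.lineMap (rho a) (rho b) r) : w = a ∨ w = b := by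
  by_contra hn
  push Not at hn
  have := h.det hw hn.1 hn.2
  have e2 := orD_on_line (rho a) (rho b) r
  rw [← e, orD_rho] at e2
  exact this (by exact_mod_cast e2)

/-- Two virtual edges sharing their first endpoint only. -/
lemma vE.share {a b d : ℤ × ℤ} (h : vE a b) (hd : d ∈ vPts) (had : a ≠ d) (hbd : b ≠ d) {r r' : ℝ}
    (e : AffineMap.lineMap (rho a) (rho b) r =
      (AffineMap.lineMap (rho a) (rho d) r' : ℝ × ℝ)) :
    (AffineMap.lineMap (rho a) (rho d) r' : ℝ × ℝ) = rho a := by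
  have h1 := h.det hd had.symm hbd.symm
  have e2 := orD_on_line (rho a) (rho b) r
  rw [e, orD_line, orD_self_left, orD_rho] at e2
  have h1' : (detZ a b d : ℝ) ≠ 0 := by exact_mod_cast h1
  have : r' = 0 := by
    have : r' * (detZ a b d : ℝ) = 0 := by linarith
    exact (mul_eq_zero.1 this).resolve_right h1'
  simp [this]

lemma vE.inter {a b c d : ℤ × ℤ} (h : vE a b) (h' : vE c d)
    (hc : c ∈ vPts) (hd : d ∈ vPts) (hne : ¬ ((a = c ∧ b = d) ∨ (a = d ∧ b = c)))
    {r r' : ℝ} (r0 : 0 ≤ r) (r1 : r ≤ 1) (r0' : 0 ≤ r') (r1' : r' ≤ 1) {p : ℝ × ℝ}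
    (e : p = AffineMap.lineMap (rho a) (rho b) r) (e' : p = AffineMap.lineMap (rho c) (rho d) r') :
    ∃ z, (z = a ∨ z = b) ∧ (z = c ∨ z = d) ∧ p = rho z := by
  have fl : ∀ x y : ℝ × ℝ, ∀ r : ℝ, (AffineMap.lineMap x y r : ℝ × ℝ) =
      AffineMap.lineMap y x (1 - r) := fun x y r => (AffineMap.lineMap_apply_one_sub y x r).symm
  by_cases h1 : a = c
  · subst h1
    refine ⟨a, Or.inl rfl, Or.inl rfl, ?_⟩
    rw [e']
    exact h.share hd h'.ne (fun hh => hne (Or.inl ⟨rfl, hh⟩)) (e.symm.trans e')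
  by_cases h2 : a = d
  · subst h2
    refine ⟨a, Or.inl rfl, Or.inr rfl, ?_⟩
    rw [fl] at e'
    rw [e']
    exact h.share hc h'.ne.symm (fun hh => hne (Or.inr ⟨rfl, hh⟩)) (e.symm.trans e')
  by_cases h3 : b = c
  · subst h3
    refine ⟨b, Or.inr rfl, Or.inl rfl, ?_⟩
    rw [fl] at e
    rw [e']
    exact h.symm.share hd h'.ne h2 (e.symm.trans e')
  by_cases h4 : b = d
  · subst h4
    refine ⟨b, Or.inr rfl, Or.inr rfl, ?_⟩
    rw [fl] at e e'
    rw [e']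
    exact h.symm.share hc h'.ne.symm h1 (e.symm.trans e')
  exfalso
  rcases h.cross h' h1 h2 h3 h4 with hs | hs
  · refine not_same_side r0' r1' (e.symm.trans e') ?_
    rw [orD_rho, orD_rho]; exact_mod_cast hs
  · refine not_same_side r0 r1 (e'.symm.trans e) ?_
    rw [orD_rho, orD_rho]; exact_mod_cast hs

/-! ### A planar storyplan: the actual drawing and the time intervals -/

/-- Interpolating polynomial of a colouring. -/
noncomputable def shearPoly (c : Col) : Polynomial ℝ :=
  Lagrange.interpolate Finset.univ (fun j : Fin 3 × Fin 4 => (colX j : ℝ))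
    (fun j => (rowY (c j) : ℝ))

lemma shearPoly_eval (c : Col) (j : Fin 3 × Fin 4) :
    (shearPoly c).eval (colX j : ℝ) = (rowY (c j) : ℝ) := by
  unfold shearPoly
  refine Lagrange.eval_interpolate_at_node (v := fun j : Fin 3 × Fin 4 => (colX j : ℝ))
    (fun j => (rowY (c j) : ℝ)) ?_ (Finset.mem_univ j)
  intro a _ b _ h
  have h : (colX a : ℝ) = (colX b : ℝ) := h
  exact colX_inj a b (by exact_mod_cast h)

/-- The vertical shear attached to a colouring. -/
noncomputable def shear (c : Col) (p : ℝ × ℝ) : ℝ × ℝ := (p.1, p.2 - (shearPoly c).eval p.1)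

lemma shear_inj (c : Col) : Function.Injective (shear c) := by
  intro p q h
  simp only [shear, Prod.mk.injEq] at h
  obtain ⟨h1, h2⟩ := h
  rw [h1] at h2
  exact Prod.ext h1 (by linarith)

lemma shear_cont (c : Col) : Continuous (shear c) := by
  unfold shear
  exact continuous_fst.prodMk
    (continuous_snd.sub ((shearPoly c).continuous.comp continuous_fst))

/-- Virtual position of a vertex with respect to a colouring. -/
def lab (c : Col) : GV → ℤ × ℤ
  | .f j => fP j (c j)
  | .t _ i => tP i
  | .u _ _ => uP
  | .s _ _ i _ => sP i

/-- Gadget of a vertex. -/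
def cOf : GV → Option Col
  | .f _ => none
  | .t c _ => some c
  | .u c _ => some c
  | .s c _ _ _ => some c

/-- The placement. -/
noncomputable def DD : GV → ℝ × ℝ
  | .f j => ((colX j : ℝ), 0)
  | .t c i => shear c (rho (tP i))
  | .u c _ => shear c (rho uP)
  | .s c _ i _ => shear c (rho (sP i))

/-- The vertex is a ground vertex or belongs to gadget `c`. -/
def okC (c : Col) (v : GV) : Prop := ∀ c', cOf v = some c' → c' = c

lemma DD_eq {c : Col} {v : GV} (h : okC c v) : DD v = shear c (rho (lab c v)) := by
  cases v with
  | f j => simp [DD, shear, rho, lab, fP, shearPoly_eval]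
  | t c' i => rw [h c' rfl] at *; rfl
  | u c' i => rw [h c' rfl] at *; rfl
  | s c' k i l => rw [h c' rfl] at *; rfl

lemma lab_mem (c : Col) (v : GV) : lab c v ∈ vPts := by
  obtain ⟨h1, h2, h3, h4⟩ := mem_facts
  cases v with
  | f j => exact h4 _ _
  | t c' i => exact h1 _
  | u c' i => exact h2
  | s c' k i l => exact h3 _

/-- The gadget of an edge. -/
def ec (u v : GV) : Col := ((cOf u).or (cOf v)).getD (fun _ => 0)

lemma ec_facts {u v : GV} (h : GG.Adj u v) :
    okC (ec u v) u ∧ okC (ec u v) v ∧ vE (lab (ec u v) u) (lab (ec u v) v) ∧ ec v u = ec u v ∧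
      ∀ c, okC c u → okC c v → ec u v = c := by
  obtain ⟨e1, e2, e3, e4, e5⟩ := edge_facts
  have h : gAdj u v := h
  rcases u with j | ⟨c, i⟩ | ⟨c, k⟩ | ⟨c, k, i, l⟩ <;>
  rcases v with j' | ⟨c', i'⟩ | ⟨c', k'⟩ | ⟨c', k', i', l'⟩ <;> simp only [gAdj] at h
  · subst h
    exact ⟨by simp [okC, cOf], by simp [okC, cOf, ec], (e5 _ _).symm, rfl, fun c _ h2 => h2 _ rfl⟩
  · obtain ⟨rfl, hh⟩ := h
    exact ⟨by simp [okC, cOf, ec], by simp [okC, cOf, ec], e1 _ _ hh, rfl, fun c h2 _ => h2 _ rfl⟩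
  · subst h
    exact ⟨by simp [okC, cOf, ec], by simp [okC, cOf, ec], (e2 _).symm, rfl, fun c h2 _ => h2 _ rfl⟩
  · obtain ⟨rfl, hh⟩ := h
    exact ⟨by simp [okC, cOf, ec], by simp [okC, cOf, ec], (e4 _ _ hh.symm).symm, rfl,
      fun c h2 _ => h2 _ rfl⟩
  · subst h
    exact ⟨by simp [okC, cOf, ec], by simp [okC, cOf, ec], e2 _, rfl, fun c h2 _ => h2 _ rfl⟩
  · obtain ⟨rfl, hh⟩ := h
    exact ⟨by simp [okC, cOf, ec], by simp [okC, cOf, ec], e3 _, rfl, fun c h2 _ => h2 _ rfl⟩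
  · subst h
    exact ⟨by simp [okC, cOf, ec], by simp [okC, cOf, ec], e5 _ _, rfl, fun c h2 _ => h2 _ rfl⟩
  · obtain ⟨rfl, hh⟩ := h
    exact ⟨by simp [okC, cOf, ec], by simp [okC, cOf, ec], e4 _ _ (by simpa using hh), rfl,
      fun c h2 _ => h2 _ rfl⟩
  · obtain ⟨rfl, hh⟩ := h
    exact ⟨by simp [okC, cOf, ec], by simp [okC, cOf, ec], (e3 _).symm, rfl,
      fun c h2 _ => h2 _ rfl⟩

/-- The edge curves. -/
noncomputable def curve (u v : GV) (h : GG.Adj u v) : Path (DD u) (DD v) where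
  toFun τ := shear (ec u v)
    (AffineMap.lineMap (rho (lab (ec u v) u)) (rho (lab (ec u v) v)) (τ : ℝ))
  continuous_toFun := (shear_cont _).comp
    (AffineMap.lineMap_continuous.comp continuous_subtype_val)
  source' := by simp [DD_eq (ec_facts h).1]
  target' := by simp [DD_eq (ec_facts h).2.1]

lemma curve_apply (u v : GV) (h : GG.Adj u v) (τ : unitInterval) : curve u v h τ =
    shear (ec u v) (AffineMap.lineMap (rho (lab (ec u v) u)) (rho (lab (ec u v) v)) (τ : ℝ)) := rfl

/-- First time step. -/
def sT {N : ℕ} (idx : Col ≃ Fin N) : GV → ℕ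
  | .f _ => 1
  | .t c _ => 1 + 25 * (idx c).val
  | .u c k => 1 + 25 * (idx c).val + 5 * k.val
  | .s c k _ l => 1 + 25 * (idx c).val + 5 * k.val + l.val

/-- Last time step. -/
def eT {N : ℕ} (idx : Col ≃ Fin N) : GV → ℕ
  | .f _ => 25 * N
  | .t c _ => 1 + 25 * (idx c).val + 24
  | .u c k => 1 + 25 * (idx c).val + 5 * k.val + 4
  | .s c k _ l => 1 + 25 * (idx c).val + 5 * k.val + l.val

lemma vis_ok {N : ℕ} (idx : Col ≃ Fin N) {τ : ℕ} (h1 : 1 ≤ τ) (h2 : τ ≤ 25 * N) :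
    ∃ c, ∀ v, sT idx v ≤ τ → τ ≤ eT idx v → okC c v := by
  refine ⟨idx.symm ⟨(τ - 1) / 25, by omega⟩, ?_⟩
  intro v hs he c' hc'
  rw [Equiv.eq_symm_apply]
  apply Fin.ext
  cases v with
  | f j => simp [cOf] at hc'
  | t c i =>
    obtain rfl : c = c' := by simpa [cOf] using hc'
    simp only [sT, eT] at hs he ⊢; omega
  | u c k =>
    obtain rfl : c = c' := by simpa [cOf] using hc'
    have := k.isLt
    simp only [sT, eT] at hs he ⊢; omega
  | s c k i l =>
    obtain rfl : c = c' := by simpa [cOf] using hc'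
    have := k.isLt
    have := l.isLt
    simp only [sT, eT] at hs he ⊢; omega

lemma lab_inj {N : ℕ} {idx : Col ≃ Fin N} {τ : ℕ} {c : Col} {v w : GV} (hv : okC c v) (hw : okC c w)
    (h1 : sT idx v ≤ τ) (h2 : τ ≤ eT idx v) (h3 : sT idx w ≤ τ) (h4 : τ ≤ eT idx w)
    (h : lab c v = lab c w) : v = w := by
  obtain ⟨e1, e2, e3, e4, e5, e6, e7, e8⟩ := inj_facts
  rcases v with j | ⟨c, i⟩ | ⟨c, k⟩ | ⟨c, k, i, l⟩ <;>
  rcases w with j' | ⟨c', i'⟩ | ⟨c', k'⟩ | ⟨c', k', i', l'⟩ <;> simp only [lab] at h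
  · rw [colX_inj j j' (congrArg Prod.fst h)]
  · exact absurd h (e7 _ _ _)
  · exact absurd h (e6 _ _)
  · exact absurd h (e8 _ _ _)
  · exact absurd h.symm (e7 _ _ _)
  · rw [hv _ rfl, hw _ rfl, e1 _ _ h]
  · exact absurd h (e3 _)
  · exact absurd h.symm (e5 _ _)
  · exact absurd h.symm (e6 _ _)
  · exact absurd h.symm (e3 _)
  · obtain rfl := hv _ rfl
    obtain rfl := hw _ rfl
    simp only [sT, eT] at h1 h2 h3 h4
    rw [show k = k' from Fin.ext (by omega)]
  · exact absurd h.symm (e4 _)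
  · exact absurd h.symm (e8 _ _ _)
  · exact absurd h (e5 _ _)
  · exact absurd h (e4 _)
  · obtain rfl := hv _ rfl
    obtain rfl := hw _ rfl
    have := l.isLt
    have := l'.isLt
    simp only [sT, eT] at h1 h2 h3 h4
    rw [show k = k' from Fin.ext (by omega), show l = l' from Fin.ext (by omega), e2 _ _ h]

lemma co_occur {N : ℕ} (idx : Col ≃ Fin N) {u v : GV} (h : GG.Adj u v) :
    ∃ t, sT idx u ≤ t ∧ t ≤ eT idx u ∧ sT idx v ≤ t ∧ t ≤ eT idx v := by
  have h : gAdj u v := h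
  refine ⟨max (sT idx u) (sT idx v), ?_⟩
  rcases u with j | ⟨c, i⟩ | ⟨c, k⟩ | ⟨c, k, i, l⟩ <;>
  rcases v with j' | ⟨c', i'⟩ | ⟨c', k'⟩ | ⟨c', k', i', l'⟩ <;> simp only [gAdj] at h
  · have := (idx c').isLt
    simp only [sT, eT]; omega
  · obtain ⟨rfl, h⟩ := h
    simp only [sT, eT]; omega
  · subst h
    simp only [sT, eT]; omega
  · obtain ⟨rfl, h⟩ := h
    simp only [sT, eT]; omega
  · subst h
    simp only [sT, eT]; omega
  · obtain ⟨rfl, rfl⟩ := h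
    simp only [sT, eT]; omega
  · have := (idx c).isLt
    simp only [sT, eT]; omega
  · obtain ⟨rfl, h⟩ := h
    simp only [sT, eT]; omega
  · obtain ⟨rfl, rfl⟩ := h
    simp only [sT, eT]; omega

theorem has_planar_aux {N : ℕ} (idx : Col ≃ Fin N) : HasPlanarStoryplan GG := by
  have hN : 0 < N := lt_of_le_of_lt (Nat.zero_le _) (idx fun _ => 0).isLt
  refine ⟨25 * N, sT idx, eT idx, DD, curve, by omega, ?_, ?_, ?_, ?_, ?_⟩
  · intro v
    rcases v with j | ⟨c, i⟩ | ⟨c, k⟩ | ⟨c, k, i, l⟩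
    · simp only [sT, eT]; omega
    · have := (idx c).isLt
      simp only [sT, eT]; omega
    · have := (idx c).isLt
      simp only [sT, eT]; omega
    · have := (idx c).isLt
      simp only [sT, eT]; omega
  · intro u v h
    ext1
    funext τ
    rw [Path.symm_apply, curve_apply, Function.comp_apply, curve_apply, (ec_facts h).2.2.2.1, unitInterval.coe_symm_eq,
      AffineMap.lineMap_apply_one_sub]
  · intro u v h τ τ' e
    rw [curve_apply, curve_apply] at e
    have e := shear_inj _ e
    have hne : rho (lab (ec u v) u) ≠ rho (lab (ec u v) v) :=
      fun hh => (ec_facts h).2.2.1.ne (rho_inj hh)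
    exact Subtype.ext (AffineMap.lineMap_injective ℝ hne e)
  · intro u v h
    exact co_occur idx h
  · intro τ h1 h2
    obtain ⟨c, hc⟩ := vis_ok idx h1 h2
    refine ⟨?_, ?_, ?_⟩
    · rintro v ⟨a1, a2⟩ w ⟨b1, b2⟩ e
      have ov := hc v a1 a2
      have ow := hc w b1 b2
      rw [DD_eq ov, DD_eq ow] at e
      exact lab_inj ov ow a1 a2 b1 b2 (rho_inj (shear_inj _ e))
    · rintro u v h w ⟨a1, a2⟩ ⟨b1, b2⟩ ⟨d1, d2⟩ ⟨r, hr⟩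
      have ou := hc u a1 a2
      have ov := hc v b1 b2
      have ow := hc w d1 d2
      obtain ⟨-, -, hE, -, hec⟩ := ec_facts h
      rw [curve_apply, DD_eq ow] at hr
      rw [hec c ou ov] at hr hE
      have hr := shear_inj _ hr
      rcases hE.vertex (lab_mem c w) hr.symm with e | e
      · exact Or.inl (lab_inj ow ou d1 d2 a1 a2 e)
      · exact Or.inr (lab_inj ow ov d1 d2 b1 b2 e)
    · rintro u v x y h h' ⟨a1, a2⟩ ⟨b1, b2⟩ ⟨d1, d2⟩ ⟨f1, f2⟩ hne p ⟨⟨r, hr⟩, ⟨r', hr'⟩⟩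
      have ou := hc u a1 a2
      have ov := hc v b1 b2
      have ox := hc x d1 d2
      have oy := hc y f1 f2
      obtain ⟨-, -, hE, -, hec⟩ := ec_facts h
      obtain ⟨-, -, hE', -, hec'⟩ := ec_facts h'
      rw [curve_apply] at hr hr'
      rw [hec c ou ov] at hr hE
      rw [hec' c ox oy] at hr' hE'
      have e := shear_inj _ (hr.trans hr'.symm)
      obtain ⟨z, hz1, hz2, hz3⟩ := hE.inter hE' (lab_mem c x) (lab_mem c y) (by
        rintro (⟨i1, i2⟩ | ⟨i1, i2⟩)
        · exact hne (Or.inl ⟨lab_inj ou ox a1 a2 d1 d2 i1, lab_inj ov oy b1 b2 f1 f2 i2⟩)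
        · exact hne (Or.inr ⟨lab_inj ou oy a1 a2 f1 f2 i1, lab_inj ov ox b1 b2 d1 d2 i2⟩))
        r.2.1 r.2.2 r'.2.1 r'.2.2 rfl e
      rw [hz3] at hr
      rcases hz1 with rfl | rfl <;> rcases hz2 with i | i
      · exact ⟨u, Or.inl rfl, Or.inl (lab_inj ou ox a1 a2 d1 d2 i), by rw [DD_eq ou, hr]⟩
      · exact ⟨u, Or.inl rfl, Or.inr (lab_inj ou oy a1 a2 f1 f2 i), by rw [DD_eq ou, hr]⟩
      · exact ⟨v, Or.inr rfl, Or.inl (lab_inj ov ox b1 b2 d1 d2 i), by rw [DD_eq ov, hr]⟩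
      · exact ⟨v, Or.inr rfl, Or.inr (lab_inj ov oy b1 b2 f1 f2 i), by rw [DD_eq ov, hr]⟩

theorem has_planar : HasPlanarStoryplan GG := has_planar_aux (Fintype.equivFin Col)

/-- Injection of the vertex set into a finite type. -/
def gvCode : GV → (Fin 3 × Fin 4) ⊕ (Col × Fin 3) ⊕ (Col × Fin 5) ⊕ (Col × Fin 5 × Fin 3 × Fin 5)
  | .f j => .inl j
  | .t c i => .inr (.inl (c, i))
  | .u c k => .inr (.inr (.inl (c, k)))
  | .s c k i l => .inr (.inr (.inr (c, k, i, l)))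

lemma gvCode_inj : Function.Injective gvCode := by
  rintro (_ | _ | _ | _) (_ | _ | _ | _) h <;> simp [gvCode] at h ⊢ <;> exact h

lemma gv_finite : Finite GV := Finite.of_injective gvCode gvCode_inj


/-- There exists a finite simple graph that admits a planar
(topological) storyplan but does not admit a planar geometric storyplan. -/
theorem geometry_matters :
    ∃ (V : Type) (_ : Fintype V) (G : SimpleGraph V),
      HasPlanarStoryplan G ∧ ¬ HasGeomStoryplan G := by
  exact ⟨GV, @Fintype.ofFinite GV gv_finite, GG, has_planar, not_geom⟩
end

section
/- In every planar geometric storyplan of the graph G, at least 6 of the eight apex vertices q satisfy: for every time step t in the visible interval A(q), all twelve cycle vertices are visible at t. -/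
/-- The 28 vertices of the graph `G`: cycle vertices `a i`, `b i`, `c i`
(`i ∈ Fin 4`), apex vertices `q i j` and edge vertices `r i j`
(`i ∈ Fin 4`, `j ∈ Fin 2`). -/
inductive GVert : Type
  | a : Fin 4 → GVert
  | b : Fin 4 → GVert
  | c : Fin 4 → GVert
  | q : Fin 4 → Fin 2 → GVert
  | r : Fin 4 → Fin 2 → GVert
  deriving DecidableEq

/-- Base relation generating the edges of `G`: the three 4-cycles
`A`, `B`, `C`; each apex vertex `q i j` adjacent to all twelve cycle vertices;
each edge vertex `r i j` adjacent to `q i j` and to the six cycle vertices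
`a i, a (i+1), b i, b (i+1), c i, c (i+1)`. -/
def GRel : GVert → GVert → Prop
  | .a i, .a k => k = i + 1
  | .b i, .b k => k = i + 1
  | .c i, .c k => k = i + 1
  | .q _ _, .a _ => True
  | .q _ _, .b _ => True
  | .q _ _, .c _ => True
  | .r i j, .q i' j' => i' = i ∧ j' = j
  | .r i _, .a k => k = i ∨ k = i + 1
  | .r i _, .b k => k = i ∨ k = i + 1
  | .r i _, .c k => k = i ∨ k = i + 1
  | _, _ => False

/-- The graph `G` from the paper (28 vertices). -/
def GraphG : SimpleGraph GVert := SimpleGraph.fromRel GRel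

/-- Vertex `v` is visible at time `t`. -/
def Visible (s e : GVert → ℕ) (t : ℕ) (v : GVert) : Prop :=
  s v ≤ t ∧ t ≤ e v

/-- All twelve cycle vertices are visible at time `t`. -/
def CyclesVisible (s e : GVert → ℕ) (t : ℕ) : Prop :=
  ∀ k : Fin 4, Visible s e t (.a k) ∧ Visible s e t (.b k) ∧ Visible s e t (.c k)

/-! ### Geometry: poles at `(0,0)` and `(1,0)` -/

/-- The two segments are disjoint. -/
def SegDisj (A B C E : ℝ × ℝ) : Prop :=
  ∀ p, p ∈ segment ℝ A B → p ∈ segment ℝ C E → False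

/-- Two-segment paths through `X` and `Y` from pole `P` to pole `Q` have independent edges disjoint. -/
def PathDisj (P Q X Y : ℝ × ℝ) : Prop := SegDisj P X Q Y ∧ SegDisj P Y Q X

/-- The order of points by angle at the pole `(0,0)`. -/
def Below (X Y : ℝ × ℝ) : Prop :=
  (X.2 < 0 ∧ 0 ≤ Y.2) ∨ (X.2 ≤ 0 ∧ 0 < Y.2) ∨ (0 < X.2 * Y.2 ∧ 0 < X.1 * Y.2 - X.2 * Y.1)

/-- Reflection in the horizontal axis. -/
def flipY (X : ℝ × ℝ) : ℝ × ℝ := (X.1, -X.2)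

theorem mem_seg_iff (A B p : ℝ × ℝ) : p ∈ segment ℝ A B ↔
    ∃ t : ℝ, 0 ≤ t ∧ t ≤ 1 ∧ p.1 = (1 - t) * A.1 + t * B.1 ∧ p.2 = (1 - t) * A.2 + t * B.2 := by
  constructor
  · rintro ⟨a, b, ha, hb, hab, rfl⟩
    obtain rfl : a = 1 - b := by linarith
    exact ⟨b, hb, by linarith, by simp, by simp⟩
  · rintro ⟨t, h0, h1, h2, h3⟩
    refine ⟨1 - t, t, by linarith, h0, by ring, ?_⟩
    ext <;> simp [h2, h3]

theorem flipY_mem {A B p : ℝ × ℝ} (h : p ∈ segment ℝ (flipY A) (flipY B)) :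
    flipY p ∈ segment ℝ A B := by
  rw [mem_seg_iff] at *
  obtain ⟨t, h0, h1, h2, h3⟩ := h
  refine ⟨t, h0, h1, h2, ?_⟩
  simp only [flipY] at *
  linarith

theorem SegDisj.flipped {A B C E : ℝ × ℝ} (h : SegDisj A B C E) :
    SegDisj (flipY A) (flipY B) (flipY C) (flipY E) :=
  fun p h1 h2 => h (flipY p) (flipY_mem h1) (flipY_mem h2)

theorem flipY_zero : flipY (0, 0) = (0, 0) := by simp [flipY]
theorem flipY_one : flipY (1, 0) = (1, 0) := by simp [flipY]

theorem PathDisj.flipped {X Y : ℝ × ℝ} (h : PathDisj (0, 0) (1, 0) X Y) :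
    PathDisj (0, 0) (1, 0) (flipY X) (flipY Y) := by
  have h1 := h.1.flipped
  have h2 := h.2.flipped
  rw [flipY_zero, flipY_one] at h1 h2
  exact ⟨h1, h2⟩

theorem PathDisj.symm {P Q X Y : ℝ × ℝ} (h : PathDisj P Q X Y) : PathDisj P Q Y X := ⟨h.2, h.1⟩

theorem Below.flipped {X Y : ℝ × ℝ} (h : Below X Y) : Below (flipY Y) (flipY X) := by
  simp only [Below, flipY] at *
  rcases h with h | h | h
  · right; left; constructor <;> linarith [h.1, h.2]
  · left; constructor <;> linarith [h.1, h.2]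
  · right; right; constructor <;> nlinarith [h.1, h.2]

theorem Below.trans {X Y Z : ℝ × ℝ} (h : Below X Y) (h' : Below Y Z) : Below X Z := by
  obtain ⟨x1, x2⟩ := X
  obtain ⟨y1, y2⟩ := Y
  obtain ⟨z1, z2⟩ := Z
  simp only [Below] at *
  rcases h with h | h | ⟨h, h2⟩ <;> rcases h' with h' | h' | ⟨h', h2'⟩
  · left; constructor <;> linarith [h.1, h.2, h'.1, h'.2]
  · left; constructor <;> linarith [h.1, h.2, h'.1, h'.2]
  · left; refine ⟨h.1, ?_⟩
    by_contra hc; push Not at hc; nlinarith [h.2]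
  · left; constructor <;> linarith [h.1, h.2, h'.1, h'.2]
  · right; left; constructor <;> linarith [h.1, h.2, h'.1, h'.2]
  · right; left; refine ⟨h.1, ?_⟩
    by_contra hc; push Not at hc; nlinarith [h.2]
  · left; refine ⟨?_, h'.2⟩
    by_contra hc; push Not at hc; nlinarith [h'.1]
  · right; left; refine ⟨?_, h'.2⟩
    by_contra hc; push Not at hc; nlinarith [h'.1]
  · right; right
    rcases pos_and_pos_or_neg_and_neg_of_mul_pos h with ⟨hx, hy⟩ | ⟨hx, hy⟩
    · have hz : 0 < z2 := by by_contra hc; push Not at hc; nlinarith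
      refine ⟨by positivity, ?_⟩
      have : 0 < (x1 * z2 - x2 * z1) * y2 := by
        have e1 := mul_pos h2 hz
        have e2 := mul_pos h2' hx
        nlinarith
      by_contra hc; push Not at hc; nlinarith
    · have hz : z2 < 0 := by by_contra hc; push Not at hc; nlinarith
      refine ⟨mul_pos_of_neg_of_neg hx hz, ?_⟩
      have : (x1 * z2 - x2 * z1) * y2 < 0 := by
        have e1 := mul_neg_of_pos_of_neg h2 hz
        have e2 := mul_neg_of_pos_of_neg h2' hx
        nlinarith
      by_contra hc; push Not at hc; nlinarith

theorem Below.irrefl {X : ℝ × ℝ} (h : Below X X) : False := by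
  simp only [Below] at h
  rcases h with h | h | h
  · linarith [h.1, h.2]
  · linarith [h.1, h.2]
  · linarith [h.2]

/-- A common neighbour on the axis lies strictly between the poles. -/
theorem axis_between {X Y : ℝ × ℝ} (h : PathDisj (0, 0) (1, 0) X Y) (hX : X.2 = 0) :
    0 < X.1 ∧ X.1 < 1 := by
  constructor
  · by_contra hc
    push Not at hc
    refine h.2 (0, 0) (left_mem_segment _ _ _) ?_
    rw [mem_seg_iff]
    have : 0 < 1 - X.1 := by linarith
    refine ⟨1 / (1 - X.1), by positivity, ?_, ?_, by simp [hX]⟩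
    · rw [div_le_one this]; linarith
    · simp; field_simp; ring
  · by_contra hc
    push Not at hc
    refine h.1 (1, 0) ?_ (left_mem_segment _ _ _)
    rw [mem_seg_iff]
    have : 0 < X.1 := by linarith
    refine ⟨1 / X.1, by positivity, ?_, ?_, by simp [hX]⟩
    · rw [div_le_one this]; linarith
    · simp; field_simp

/-- Points on a common ray from the pole are impossible. -/
theorem ray_aux {X Y : ℝ × ℝ} (h : PathDisj (0, 0) (1, 0) X Y) (l : ℝ) (hl : 0 < l)
    (h1 : X.1 = l * Y.1) (h2 : X.2 = l * Y.2) : False := by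
  rcases le_total l 1 with hl1 | hl1
  · refine h.2 X ?_ (right_mem_segment _ _ _)
    rw [mem_seg_iff]
    exact ⟨l, hl.le, hl1, by simp [h1], by simp [h2]⟩
  · refine h.1 Y ?_ (right_mem_segment _ _ _)
    rw [mem_seg_iff]
    refine ⟨1 / l, by positivity, by rw [div_le_one hl]; exact hl1, ?_, ?_⟩
    · simp [h1]; field_simp
    · simp [h2]; field_simp

theorem below_total {X Y : ℝ × ℝ} (h : PathDisj (0, 0) (1, 0) X Y) : Below X Y ∨ Below Y X := by
  have hray := fun l hl h1 h2 => ray_aux h l hl h1 h2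
  have same : 0 < X.2 * Y.2 → Below X Y ∨ Below Y X := by
    intro hs
    have hy : Y.2 ≠ 0 := by rintro h0; simp [h0] at hs
    rcases lt_trichotomy (X.1 * Y.2 - X.2 * Y.1) 0 with hd | hd | hd
    · right; right; right; constructor <;> linarith
    · exfalso
      refine hray (X.2 / Y.2) ?_ ?_ ?_
      · have : X.2 / Y.2 = X.2 * Y.2 / Y.2 ^ 2 := by field_simp
        rw [this]; positivity
      · field_simp; linarith
      · field_simp
    · left; right; right; constructor <;> linarith
  rcases lt_trichotomy X.2 0 with hx | hx | hx <;> rcases lt_trichotomy Y.2 0 with hy | hy | hy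
  · exact same (mul_pos_of_neg_of_neg hx hy)
  · left; left; constructor <;> linarith
  · left; left; constructor <;> linarith
  · right; left; constructor <;> linarith
  · exfalso
    have a1 := axis_between h hx
    have a2 := axis_between h.symm hy
    refine hray (X.1 / Y.1) (div_pos a1.1 a2.1) ?_ (by simp [hx, hy])
    field_simp [a2.1.ne']
  · left; right; left; constructor <;> linarith
  · right; left; constructor <;> linarith
  · right; right; left; constructor <;> linarith
  · exact same (mul_pos hx hy)

/-- `X` below `Y` in the upper half plane: `X` is on the inner side of `QY`. -/
theorem upper_inner {X Y : ℝ × ℝ} (h : PathDisj (0, 0) (1, 0) X Y) (hX : 0 < X.2) (hY : 0 < Y.2)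
    (hd : 0 < X.1 * Y.2 - X.2 * Y.1) : 0 ≤ (Y.1 - 1) * X.2 - Y.2 * (X.1 - 1) := by
  by_contra hc
  push Not at hc
  obtain ⟨x1, x2⟩ := X
  obtain ⟨y1, y2⟩ := Y
  simp only at *
  -- the segments `P X` and `Q Y` cross
  have hden : 0 < x1 * y2 - x2 * (y1 - 1) := by nlinarith
  refine h.1 (y2 / (x1 * y2 - x2 * (y1 - 1)) * x1, y2 / (x1 * y2 - x2 * (y1 - 1)) * x2) ?_ ?_
  · rw [mem_seg_iff]
    refine ⟨y2 / (x1 * y2 - x2 * (y1 - 1)), by positivity, ?_, by simp, by simp⟩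
    rw [div_le_one hden]; nlinarith
  · rw [mem_seg_iff]
    refine ⟨x2 / (x1 * y2 - x2 * (y1 - 1)), by positivity, ?_, ?_, ?_⟩
    · rw [div_le_one hden]; nlinarith
    · simp only
      obtain ⟨d, hd'⟩ : ∃ d, d = x1 * y2 - x2 * (y1 - 1) := ⟨_, rfl⟩
      rw [← hd'] at hden ⊢
      field_simp
      linarith
    · simp only
      have := hden.ne'
      field_simp
      ring

/-- A segment in the closed upper half plane leaving a triangle over the base crosses a leg. -/
theorem leave_triangle {M N Y : ℝ × ℝ} (hY : 0 < Y.2) (hM : 0 ≤ M.2) (hN : 0 ≤ N.2)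
    (m1 : 0 ≤ M.1 * Y.2 - M.2 * Y.1) (m2 : 0 ≤ (Y.1 - 1) * M.2 - Y.2 * (M.1 - 1))
    (hn : N.1 * Y.2 - N.2 * Y.1 ≤ 0 ∨ (Y.1 - 1) * N.2 - Y.2 * (N.1 - 1) ≤ 0) :
    ∃ p ∈ segment ℝ M N, p ∈ segment ℝ (0, 0) Y ∨ p ∈ segment ℝ (1, 0) Y := by
  obtain ⟨y1, y2⟩ := Y
  obtain ⟨a1, a2⟩ := M
  obtain ⟨b1, b2⟩ := N
  simp only at *
  let f : ℝ → ℝ := fun t => min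
    (((1 - t) * a1 + t * b1) * y2 - ((1 - t) * a2 + t * b2) * y1)
    ((y1 - 1) * ((1 - t) * a2 + t * b2) - y2 * (((1 - t) * a1 + t * b1) - 1))
  have hf : ContinuousOn f (Set.Icc 0 1) := by
    apply Continuous.continuousOn
    fun_prop
  have h0 : 0 ≤ f 0 := by simp [f]; constructor <;> linarith
  have h1 : f 1 ≤ 0 := by
    simp only [f, min_le_iff]
    rcases hn with hn | hn
    · left; linarith
    · right; linarith
  obtain ⟨t, ⟨ht0, ht1⟩, ht⟩ := intermediate_value_Icc' (zero_le_one) hf ⟨h1, h0⟩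
  refine ⟨((1 - t) * a1 + t * b1, (1 - t) * a2 + t * b2), ?_, ?_⟩
  · rw [mem_seg_iff]; exact ⟨t, ht0, ht1, rfl, rfl⟩
  · have hw2 : 0 ≤ (1 - t) * a2 + t * b2 := by
      have : 0 ≤ 1 - t := by linarith
      positivity
    simp only [f] at ht
    generalize (1 - t) * a1 + t * b1 = w1 at *
    generalize (1 - t) * a2 + t * b2 = w2 at *
    rcases min_choice (w1 * y2 - w2 * y1) ((y1 - 1) * w2 - y2 * (w1 - 1)) with hc | hc
    · left
      have g2 := min_le_right (w1 * y2 - w2 * y1) ((y1 - 1) * w2 - y2 * (w1 - 1))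
      rw [ht] at g2 hc
      rw [mem_seg_iff]
      refine ⟨w2 / y2, by positivity, ?_, ?_, ?_⟩
      · rw [div_le_one hY]; nlinarith
      · simp; field_simp; linarith
      · simp; field_simp
    · right
      have g2 := min_le_left (w1 * y2 - w2 * y1) ((y1 - 1) * w2 - y2 * (w1 - 1))
      rw [ht] at g2 hc
      rw [mem_seg_iff]
      refine ⟨w2 / y2, by positivity, ?_, ?_, ?_⟩
      · rw [div_le_one hY]; nlinarith
      · simp; field_simp; linarith
      · simp; field_simp

/-- `XZ` is disjoint from the path through `Y`. -/
def EdgeDisj (P Q X Z Y : ℝ × ℝ) : Prop := SegDisj X Z P Y ∧ SegDisj X Z Q Y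

theorem SegDisj.swap {A B C E : ℝ × ℝ} (h : SegDisj A B C E) : SegDisj B A C E := by
  intro p hp; rw [segment_symm] at hp; exact h p hp

theorem EdgeDisj.swap {P Q X Z Y : ℝ × ℝ} (h : EdgeDisj P Q X Z Y) : EdgeDisj P Q Z X Y :=
  ⟨h.1.swap, h.2.swap⟩

theorem EdgeDisj.flipped {X Z Y : ℝ × ℝ} (h : EdgeDisj (0, 0) (1, 0) X Z Y) :
    EdgeDisj (0, 0) (1, 0) (flipY X) (flipY Z) (flipY Y) := by
  have h1 := h.1.flipped
  have h2 := h.2.flipped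
  rw [flipY_zero] at h1
  rw [flipY_one] at h2
  exact ⟨h1, h2⟩

theorem leave_contra {X Z M N Y : ℝ × ℝ} (hE : EdgeDisj (0, 0) (1, 0) X Z Y)
    (hMX : M ∈ segment ℝ X Z) (hNX : N ∈ segment ℝ X Z)
    (hY : 0 < Y.2) (hM : 0 ≤ M.2) (hN : 0 ≤ N.2)
    (m1 : 0 ≤ M.1 * Y.2 - M.2 * Y.1) (m2 : 0 ≤ (Y.1 - 1) * M.2 - Y.2 * (M.1 - 1))
    (hn : N.1 * Y.2 - N.2 * Y.1 ≤ 0 ∨ (Y.1 - 1) * N.2 - Y.2 * (N.1 - 1) ≤ 0) : False := by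
  obtain ⟨p, hp, hq⟩ := leave_triangle hY hM hN m1 m2 hn
  have hp' := (convex_segment X Z).segment_subset hMX hNX hp
  rcases hq with hq | hq
  · exact hE.1 p hp' hq
  · exact hE.2 p hp' hq

/-- Nested case: everything in the closed upper half plane. -/
theorem nested_upper {X Y Z : ℝ × ℝ} (hXY : PathDisj (0, 0) (1, 0) X Y)
    (hE : EdgeDisj (0, 0) (1, 0) X Z Y)
    (b1 : Below X Y) (b2 : Below Y Z) (hX : 0 ≤ X.2) : False := by
  have hY : 0 < Y.2 := by
    rcases b1 with h | h | h
    · linarith [h.1]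
    · exact h.2
    · by_contra hc; push Not at hc; nlinarith [h.1]
  have hZ : 0 < Z.2 ∧ 0 < Y.1 * Z.2 - Y.2 * Z.1 := by
    rcases b2 with h | h | h
    · linarith [h.1]
    · linarith [h.1]
    · refine ⟨?_, h.2⟩
      by_contra hc; push Not at hc; nlinarith [h.1]
  have hin : 0 ≤ X.1 * Y.2 - X.2 * Y.1 ∧ 0 ≤ (Y.1 - 1) * X.2 - Y.2 * (X.1 - 1) := by
    rcases hX.eq_or_lt with h0 | h0
    · obtain ⟨c1, c2⟩ := axis_between hXY h0.symm
      rw [← h0]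
      constructor <;> nlinarith
    · have : 0 < X.1 * Y.2 - X.2 * Y.1 := by
        rcases b1 with h | h | h
        · linarith [h.1]
        · linarith [h.1]
        · exact h.2
      exact ⟨this.le, upper_inner hXY h0 hY this⟩
  exact leave_contra hE (left_mem_segment _ _ _) (right_mem_segment _ _ _) hY hX hZ.1.le hin.1 hin.2
    (Or.inl (by linarith [hZ.2]))

/-- The edge passes between the poles. -/
theorem cross_mid {X Y Z W : ℝ × ℝ} (hYX : PathDisj (0, 0) (1, 0) Y X)
    (hE : EdgeDisj (0, 0) (1, 0) X Z Y)
    (b2 : Below Y Z) (hZ : 0 < Z.2) (hW : W ∈ segment ℝ X Z) (hW2 : W.2 = 0)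
    (w0 : 0 ≤ W.1) (w1 : W.1 ≤ 1) (hY : 0 ≤ Y.2) : False := by
  rcases hY.eq_or_lt with h0 | h0
  · obtain ⟨c1, c2⟩ := axis_between hYX h0.symm
    rcases le_total W.1 Y.1 with h | h
    · refine hE.1 W hW ?_
      rw [mem_seg_iff]
      refine ⟨W.1 / Y.1, by positivity, by rw [div_le_one c1]; exact h, ?_, by simp [hW2, ← h0]⟩
      simp; field_simp
    · refine hE.2 W hW ?_
      rw [mem_seg_iff]
      have : 0 < 1 - Y.1 := by linarith
      refine ⟨(1 - W.1) / (1 - Y.1), div_nonneg (by linarith) this.le,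
        by rw [div_le_one this]; linarith, ?_, by simp [hW2, ← h0]⟩
      simp; field_simp; ring
  · have hd : 0 < Y.1 * Z.2 - Y.2 * Z.1 := by
      rcases b2 with h | h | h
      · linarith [h.1]
      · linarith [h.1]
      · exact h.2
    refine leave_contra hE hW (right_mem_segment _ _ _) h0 hW2.ge hZ.le ?_ ?_ (Or.inl (by linarith))
    · rw [hW2]; nlinarith
    · rw [hW2]; nlinarith

/-- The edge `XZ` cannot separate `Y` from `U` (first version). -/
theorem no_sep_aux {X Y Z U : ℝ × ℝ} (hXY : PathDisj (0, 0) (1, 0) X Y)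
    (hYZ : PathDisj (0, 0) (1, 0) Y Z) (hZU : PathDisj (0, 0) (1, 0) Z U)
    (hE : EdgeDisj (0, 0) (1, 0) X Z Y) (hE' : EdgeDisj (0, 0) (1, 0) X Z U)
    (b1 : Below X Y) (b2 : Below Y Z) (b3 : Below Z U) : False := by
  rcases le_or_gt 0 X.2 with hX | hX
  · exact nested_upper hXY hE b1 b2 hX
  rcases le_or_gt Z.2 0 with hZ | hZ
  · exact nested_upper hYZ.symm.flipped hE.swap.flipped b2.flipped b1.flipped (by simp [flipY]; exact hZ)
  -- the crossing point with the axis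
  have hden : 0 < Z.2 - X.2 := by linarith
  obtain ⟨W, hW, hW2⟩ : ∃ W ∈ segment ℝ X Z, W.2 = 0 := by
    refine ⟨((1 - -X.2 / (Z.2 - X.2)) * X.1 + -X.2 / (Z.2 - X.2) * Z.1, 0), ?_, rfl⟩
    rw [mem_seg_iff]
    refine ⟨-X.2 / (Z.2 - X.2), div_nonneg (by linarith) hden.le,
      by rw [div_le_one hden]; linarith, rfl, ?_⟩
    simp; field_simp; ring
  by_cases hmid : 0 ≤ W.1 ∧ W.1 ≤ 1
  · rcases le_or_gt 0 Y.2 with hY | hY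
    · exact cross_mid hXY.symm hE b2 hZ hW hW2 hmid.1 hmid.2 hY
    · refine cross_mid (W := flipY W) hYZ.flipped hE.swap.flipped b1.flipped (by simp [flipY]; exact hX)
        ?_ (by simp [flipY, hW2]) hmid.1 hmid.2 (by simp [flipY]; exact hY.le)
      apply flipY_mem (A := flipY Z) (B := flipY X)
      simpa [flipY, segment_symm ℝ Z X] using hW
  · have hd : 0 < U.2 ∧ 0 < Z.1 * U.2 - Z.2 * U.1 := by
      rcases b3 with h | h | h
      · linarith [h.1]
      · linarith [h.1]
      · refine ⟨?_, h.2⟩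
        by_contra hc; push Not at hc; nlinarith [h.1]
    refine leave_contra hE' (right_mem_segment _ _ _) hW hd.1 hZ.le hW2.ge hd.2.le
      (upper_inner hZU hZ hd.1 hd.2) ?_
    rw [hW2]
    by_cases h0 : 0 ≤ W.1
    · right
      have : 1 < W.1 := by
        by_contra hc; push Not at hc; exact hmid ⟨h0, hc⟩
      nlinarith [hd.1]
    · left
      push Not at h0
      nlinarith [hd.1]

theorem no_sep_aux' {X Y Z U : ℝ × ℝ} (hXY : PathDisj (0, 0) (1, 0) X Y)
    (hYZ : PathDisj (0, 0) (1, 0) Y Z) (hUX : PathDisj (0, 0) (1, 0) U X)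
    (hE : EdgeDisj (0, 0) (1, 0) X Z Y) (hE' : EdgeDisj (0, 0) (1, 0) X Z U)
    (b1 : Below X Y) (b2 : Below Y Z) (b3 : Below U X) : False :=
  no_sep_aux hYZ.symm.flipped hXY.symm.flipped hUX.symm.flipped hE.swap.flipped hE'.swap.flipped
    b2.flipped b1.flipped b3.flipped

/-! ### General poles -/

/-- Affine coordinates with prescribed poles. -/
def psi (P Q X : ℝ × ℝ) : ℝ × ℝ :=
  (P.1 + X.1 * (Q.1 - P.1) - X.2 * (Q.2 - P.2), P.2 + X.1 * (Q.2 - P.2) + X.2 * (Q.1 - P.1))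

theorem psi_mem (P Q : ℝ × ℝ) {A B p : ℝ × ℝ} (h : p ∈ segment ℝ A B) :
    psi P Q p ∈ segment ℝ (psi P Q A) (psi P Q B) := by
  rw [mem_seg_iff] at *
  obtain ⟨t, h0, h1, h2, h3⟩ := h
  refine ⟨t, h0, h1, ?_, ?_⟩ <;> simp only [psi, h2, h3] <;> ring

theorem psi_zero (P Q : ℝ × ℝ) : psi P Q (0, 0) = P := by simp [psi]
theorem psi_one (P Q : ℝ × ℝ) : psi P Q (1, 0) = Q := by simp [psi]

theorem psi_surj {P Q : ℝ × ℝ} (h : P ≠ Q) (X : ℝ × ℝ) : ∃ Y, psi P Q Y = X := by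
  have hn : (Q.1 - P.1) ^ 2 + (Q.2 - P.2) ^ 2 ≠ 0 := by
    intro h0
    apply h
    ext
    · nlinarith [sq_nonneg (Q.1 - P.1), sq_nonneg (Q.2 - P.2)]
    · nlinarith [sq_nonneg (Q.1 - P.1), sq_nonneg (Q.2 - P.2)]
  refine ⟨(((X.1 - P.1) * (Q.1 - P.1) + (X.2 - P.2) * (Q.2 - P.2)) /
      ((Q.1 - P.1) ^ 2 + (Q.2 - P.2) ^ 2),
    ((X.2 - P.2) * (Q.1 - P.1) - (X.1 - P.1) * (Q.2 - P.2)) /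
      ((Q.1 - P.1) ^ 2 + (Q.2 - P.2) ^ 2)), ?_⟩
  ext <;> simp only [psi] <;> field_simp <;> ring

theorem SegDisj.of_psi {P Q A B C E : ℝ × ℝ}
    (h : SegDisj (psi P Q A) (psi P Q B) (psi P Q C) (psi P Q E)) : SegDisj A B C E :=
  fun _ h1 h2 => h _ (psi_mem P Q h1) (psi_mem P Q h2)

/-- `Y` is strictly between `X` and `Z` for the relation `R`. -/
def StrictlyBtw {α : Type*} (R : α → α → Prop) (X Z Y : α) : Prop := (R X Y ∧ R Y Z) ∨ (R Z Y ∧ R Y X)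

/-- The common neighbours of two poles are linearly ordered so that no edge separates. -/
theorem exists_order {ι : Type*} (p : ι → ℝ × ℝ) (E : ι → ι → Prop) (P Q : ℝ × ℝ) (hPQ : P ≠ Q)
    (h1 : ∀ i j, i ≠ j → SegDisj P (p i) Q (p j))
    (h2 : ∀ i j k, E i j → k ≠ i → k ≠ j → EdgeDisj P Q (p i) (p j) (p k)) :
    ∃ R : ι → ι → Prop, (∀ i, ¬ R i i) ∧ (∀ i j k, R i j → R j k → R i k) ∧
      (∀ i j, i ≠ j → R i j ∨ R j i) ∧
      (∀ i j k l, E i j → i ≠ j → k ≠ i → k ≠ j → l ≠ i → l ≠ j → StrictlyBtw R i j k → StrictlyBtw R i j l) := by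
  choose g hg using fun i => psi_surj hPQ (p i)
  have H1 : ∀ i j, i ≠ j → PathDisj (0, 0) (1, 0) (g i) (g j) := by
    intro i j hij
    constructor <;> apply SegDisj.of_psi (P := P) (Q := Q) <;> rw [psi_zero, psi_one, hg, hg]
    · exact h1 i j hij
    · exact h1 j i hij.symm
  have H2 : ∀ i j k, E i j → k ≠ i → k ≠ j → EdgeDisj (0, 0) (1, 0) (g i) (g j) (g k) := by
    intro i j k hij hi hj
    have := h2 i j k hij hi hj
    constructor <;> apply SegDisj.of_psi (P := P) (Q := Q)
    · rw [psi_zero, hg, hg, hg]; exact this.1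
    · rw [psi_one, hg, hg, hg]; exact this.2
  refine ⟨fun i j => Below (g i) (g j), fun i h => h.irrefl, fun i j k h h' => h.trans h',
    fun i j hij => below_total (H1 i j hij), ?_⟩
  intro i j k l hE hij hki hkj hli hlj hb
  have t1 := below_total (H1 i l hli.symm)
  have t2 := below_total (H1 j l hlj.symm)
  have e1 := H2 i j k hE hki hkj
  have e2 := H2 i j l hE hli hlj
  simp only [StrictlyBtw] at *
  rcases hb with hb | hb
  · rcases t1 with t1 | t1
    · rcases t2 with t2 | t2
      · exact (no_sep_aux (H1 _ _ hki.symm) (H1 _ _ hkj) (H1 _ _ hlj.symm) e1 e2 hb.1 hb.2 t2).elim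
      · exact Or.inl ⟨t1, t2⟩
    · exact (no_sep_aux' (H1 _ _ hki.symm) (H1 _ _ hkj) (H1 _ _ hli) e1 e2 hb.1 hb.2 t1).elim
  · rcases t2 with t2 | t2
    · rcases t1 with t1 | t1
      · exact (no_sep_aux (H1 _ _ hkj.symm) (H1 _ _ hki) (H1 _ _ hli.symm) e1.swap e2.swap
          hb.1 hb.2 t1).elim
      · exact Or.inr ⟨t2, t1⟩
    · exact (no_sep_aux' (H1 _ _ hkj.symm) (H1 _ _ hki) (H1 _ _ hlj) e1.swap e2.swap
        hb.1 hb.2 t2).elim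

/-! ### Combinatorics of the order -/

theorem no_four (R : Fin 4 → Fin 4 → Prop) (hi : ∀ i, ¬ R i i)
    (ht : ∀ i j k, R i j → R j k → R i k) (hc : ∀ i j, i ≠ j → R i j ∨ R j i)
    (h : ∀ j k l : Fin 4, 0 ≠ j → k ≠ 0 → k ≠ j → l ≠ 0 → l ≠ j →
      StrictlyBtw R 0 j k → StrictlyBtw R 0 j l) : False := by
  have a1 := h 1 2 3 (by decide) (by decide) (by decide) (by decide) (by decide)
  have a2 := h 1 3 2 (by decide) (by decide) (by decide) (by decide) (by decide)
  have a3 := h 2 1 3 (by decide) (by decide) (by decide) (by decide) (by decide)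
  have a4 := h 2 3 1 (by decide) (by decide) (by decide) (by decide) (by decide)
  have a5 := h 3 1 2 (by decide) (by decide) (by decide) (by decide) (by decide)
  have a6 := h 3 2 1 (by decide) (by decide) (by decide) (by decide) (by decide)
  have c01 := hc 0 1 (by decide)
  have c02 := hc 0 2 (by decide)
  have c03 := hc 0 3 (by decide)
  have c12 := hc 1 2 (by decide)
  have c13 := hc 1 3 (by decide)
  have c23 := hc 2 3 (by decide)
  have has : ∀ i j, R i j → ¬ R j i := fun i j h1 h2 => hi _ (ht _ _ _ h1 h2)
  simp only [StrictlyBtw] at *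
  clear h hc
  grind

/-- Adjacency in the 4-cycle on `0,1,2,3`, with an extra vertex `4`. -/
def E5 (i j : Fin 5) : Prop :=
  (i = 0 ∧ j = 1) ∨ (i = 1 ∧ j = 2) ∨ (i = 2 ∧ j = 3) ∨ (i = 3 ∧ j = 0)

theorem no_five (R : Fin 5 → Fin 5 → Prop) (hi : ∀ i, ¬ R i i)
    (ht : ∀ i j k, R i j → R j k → R i k) (hc : ∀ i j, i ≠ j → R i j ∨ R j i)
    (h : ∀ i j k l, E5 i j → i ≠ j → k ≠ i → k ≠ j → l ≠ i → l ≠ j →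
      StrictlyBtw R i j k → StrictlyBtw R i j l) : False := by
  have key : ∀ i j k, E5 i j → i ≠ j → k ≠ i → k ≠ j → 4 ≠ i → 4 ≠ j →
      (StrictlyBtw R i j k ↔ StrictlyBtw R i j 4) := fun i j k h1 h2 h3 h4 h5 h6 =>
    ⟨h i j k 4 h1 h2 h3 h4 h5 h6, h i j 4 k h1 h2 h5 h6 h3 h4⟩
  have e01 : E5 0 1 := by simp [E5]
  have e12 : E5 1 2 := by simp [E5]
  have e23 : E5 2 3 := by simp [E5]
  have e30 : E5 3 0 := by simp [E5]
  have k1 := key 0 1 2 e01 (by decide) (by decide) (by decide) (by decide) (by decide)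
  have k2 := key 0 1 3 e01 (by decide) (by decide) (by decide) (by decide) (by decide)
  have k3 := key 1 2 0 e12 (by decide) (by decide) (by decide) (by decide) (by decide)
  have k4 := key 1 2 3 e12 (by decide) (by decide) (by decide) (by decide) (by decide)
  have k5 := key 2 3 0 e23 (by decide) (by decide) (by decide) (by decide) (by decide)
  have k6 := key 2 3 1 e23 (by decide) (by decide) (by decide) (by decide) (by decide)
  have k7 := key 3 0 1 e30 (by decide) (by decide) (by decide) (by decide) (by decide)
  have k8 := key 3 0 2 e30 (by decide) (by decide) (by decide) (by decide) (by decide)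
  have has : ∀ i j, i ≠ j → (R j i ↔ ¬ R i j) := fun i j hij =>
    ⟨fun h1 h2 => hi _ (ht _ _ _ h1 h2), fun h1 => (hc i j hij).resolve_left h1⟩
  have r10 := has 0 1 (by decide)
  have r20 := has 0 2 (by decide)
  have r30 := has 0 3 (by decide)
  have r40 := has 0 4 (by decide)
  have r21 := has 1 2 (by decide)
  have r31 := has 1 3 (by decide)
  have r41 := has 1 4 (by decide)
  have r32 := has 2 3 (by decide)
  have r42 := has 2 4 (by decide)
  have r43 := has 3 4 (by decide)
  simp only [StrictlyBtw, r10, r20, r30, r40, r21, r31, r41, r32, r42, r43] at k1 k2 k3 k4 k5 k6 k7 k8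
  have t012 := ht 0 1 2
  have t210 := ht 2 1 0
  have t013 := ht 0 1 3
  have t310 := ht 3 1 0
  have t014 := ht 0 1 4
  have t410 := ht 4 1 0
  have t023 := ht 0 2 3
  have t320 := ht 3 2 0
  have t024 := ht 0 2 4
  have t420 := ht 4 2 0
  have t034 := ht 0 3 4
  have t430 := ht 4 3 0
  have t123 := ht 1 2 3
  have t321 := ht 3 2 1
  have t124 := ht 1 2 4
  have t421 := ht 4 2 1
  have t134 := ht 1 3 4
  have t431 := ht 4 3 1
  have t234 := ht 2 3 4
  have t432 := ht 4 3 2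
  simp only [r10, r20, r30, r40, r21, r31, r41, r32, r42, r43] at t012 t210 t013 t310 t014 t410 t023 t320 t024 t420 t034 t430 t123 t321 t124 t421 t134 t431 t234 t432
  clear key h hc has hi ht r10 r20 r30 r40 r21 r31 r41 r32 r42 r43
  grind

/-! ### Frames -/

theorem frame_segDisj {V : Type*} {G : SimpleGraph V} {S : Set V} {D : V → ℝ × ℝ}
    (hF : IsPlanarSLFrame G S D) {u v x y : V} (huv : G.Adj u v) (hxy : G.Adj x y)
    (hu : u ∈ S) (hv : v ∈ S) (hx : x ∈ S) (hy : y ∈ S)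
    (h1 : u ≠ x) (h2 : u ≠ y) (h3 : v ≠ x) (h4 : v ≠ y) :
    SegDisj (D u) (D v) (D x) (D y) := by
  intro p hp hq
  obtain ⟨z, hz1, hz2, -⟩ := hF.2.2 u v x y huv hxy hu hv hx hy (by tauto) p ⟨hp, hq⟩
  rcases hz1 with rfl | rfl <;> rcases hz2 with rfl | rfl <;> contradiction

theorem frame_order {V ι : Type*} {G : SimpleGraph V} {S : Set V} {D : V → ℝ × ℝ}
    (hF : IsPlanarSLFrame G S D) (P Q : V) (hPQ : P ≠ Q) (hP : P ∈ S) (hQ : Q ∈ S)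
    (f : ι → V) (hf : Function.Injective f) (hfS : ∀ i, f i ∈ S)
    (aP : ∀ i, G.Adj P (f i)) (aQ : ∀ i, G.Adj Q (f i))
    (E : ι → ι → Prop) (hE : ∀ i j, E i j → G.Adj (f i) (f j)) :
    ∃ R : ι → ι → Prop, (∀ i, ¬ R i i) ∧ (∀ i j k, R i j → R j k → R i k) ∧
      (∀ i j, i ≠ j → R i j ∨ R j i) ∧
      (∀ i j k l, E i j → i ≠ j → k ≠ i → k ≠ j → l ≠ i → l ≠ j →
        StrictlyBtw R i j k → StrictlyBtw R i j l) := by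
  refine exists_order (fun i => D (f i)) E (D P) (D Q) (fun h => hPQ (hF.1 hP hQ h)) ?_ ?_
  · intro i j hij
    exact frame_segDisj hF (aP i) (aQ j) hP (hfS i) hQ (hfS j) hPQ (aP j).ne (aQ i).ne'
      (hf.ne hij)
  · intro i j k hij hki hkj
    exact ⟨frame_segDisj hF (hE i j hij) (aP k) (hfS i) (hfS j) hP (hfS k) (aP i).ne'
      (hf.ne hki.symm) (aP j).ne' (hf.ne hkj.symm),
      frame_segDisj hF (hE i j hij) (aQ k) (hfS i) (hfS j) hQ (hfS k) (aQ i).ne'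
      (hf.ne hki.symm) (aQ j).ne' (hf.ne hkj.symm)⟩

theorem adj_qa (i : Fin 4) (j : Fin 2) (k : Fin 4) : GraphG.Adj (.q i j) (.a k) := by
  simp [GraphG, GRel]
theorem adj_qb (i : Fin 4) (j : Fin 2) (k : Fin 4) : GraphG.Adj (.q i j) (.b k) := by
  simp [GraphG, GRel]
theorem adj_qc (i : Fin 4) (j : Fin 2) (k : Fin 4) : GraphG.Adj (.q i j) (.c k) := by
  simp [GraphG, GRel]
theorem adj_aa (i : Fin 4) : GraphG.Adj (.a i) (.a (i + 1)) := by
  simp [GraphG, GRel]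

/-- Two apexes cannot be visible together with a 4-cycle and a further cycle vertex. -/
theorem no_two_apexes {S : Set GVert} {D : GVert → ℝ × ℝ} (hF : IsPlanarSLFrame GraphG S D)
    (x y : Fin 4 × Fin 2) (hxy : x ≠ y) (hx : GVert.q x.1 x.2 ∈ S) (hy : GVert.q y.1 y.2 ∈ S)
    (ha : ∀ k, GVert.a k ∈ S) (hb : GVert.b 0 ∈ S) : False := by
  obtain ⟨R, r1, r2, r3, r4⟩ := frame_order hF (.q x.1 x.2) (.q y.1 y.2)
    (by intro h; injection h with h1 h2; exact hxy (Prod.ext h1 h2)) hx hy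
    (![.a 0, .a 1, .a 2, .a 3, .b 0] : Fin 5 → GVert) (by decide)
    (by intro i; fin_cases i; exacts [ha 0, ha 1, ha 2, ha 3, hb])
    (by intro i; fin_cases i; exacts [adj_qa _ _ _, adj_qa _ _ _, adj_qa _ _ _, adj_qa _ _ _, adj_qb _ _ _])
    (by intro i; fin_cases i; exacts [adj_qa _ _ _, adj_qa _ _ _, adj_qa _ _ _, adj_qa _ _ _, adj_qb _ _ _])
    E5 (by
      rintro i j (⟨rfl, rfl⟩ | ⟨rfl, rfl⟩ | ⟨rfl, rfl⟩ | ⟨rfl, rfl⟩)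
      exacts [adj_aa 0, adj_aa 1, adj_aa 2, adj_aa 3])
  exact no_five R r1 r2 r3 r4

/-- Three apexes cannot be visible together with three consecutive cycle vertices. -/
theorem no_three_apexes {S : Set GVert} {D : GVert → ℝ × ℝ} (hF : IsPlanarSLFrame GraphG S D)
    (hq : ∀ i j, GVert.q i j ∈ S) (k : Fin 4)
    (h0 : GVert.a k ∈ S) (h1 : GVert.a (k + 1) ∈ S) (h2 : GVert.a (k + 1 + 1) ∈ S) : False := by
  obtain ⟨R, r1, r2, r3, r4⟩ := frame_order hF (.a k) (.a (k + 1 + 1))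
    (by clear h0 h1 h2; revert k; decide) h0 h2
    (![.a (k + 1), .q 0 0, .q 1 0, .q 2 0] : Fin 4 → GVert) (by clear h0 h1 h2; revert k; decide)
    (by intro i; fin_cases i; exacts [h1, hq 0 0, hq 1 0, hq 2 0])
    (by intro i; fin_cases i; exacts [adj_aa k, (adj_qa 0 0 k).symm, (adj_qa 1 0 k).symm, (adj_qa 2 0 k).symm])
    (by intro i; fin_cases i; exacts [(adj_aa (k + 1)).symm, (adj_qa 0 0 _).symm, (adj_qa 1 0 _).symm, (adj_qa 2 0 _).symm])
    (fun i j => i = 0 ∧ j ≠ 0) (by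
      rintro i j ⟨rfl, hj⟩
      fin_cases j
      · exact (hj rfl).elim
      exacts [(adj_qa 0 0 _).symm, (adj_qa 1 0 _).symm, (adj_qa 2 0 _).symm])
  exact no_four R r1 r2 r3 fun j k l hj => r4 0 j k l ⟨rfl, hj.symm⟩ hj

/-- The twelve cycle vertices. -/
def cyc : Fin 3 × Fin 4 → GVert
  | (0, k) => .a k
  | (1, k) => .b k
  | (2, k) => .c k

theorem adj_qcyc (i : Fin 4) (j : Fin 2) (m : Fin 3 × Fin 4) : GraphG.Adj (.q i j) (cyc m) := by
  obtain ⟨m, k⟩ := m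
  fin_cases m
  exacts [adj_qa _ _ _, adj_qb _ _ _, adj_qc _ _ _]

/-- In every planar geometric storyplan of `G`, at least 6 of
the eight apex vertices `q i j` satisfy: at every time step in the visible
interval of `q i j`, all twelve cycle vertices are visible. -/
theorem six_apexes_see_all_cycles
    (len : ℕ) (s e : GVert → ℕ) (D : GVert → ℝ × ℝ)
    (hSP : IsGeomStoryplan GraphG len s e D) :
    ∃ S : Finset (Fin 4 × Fin 2), 6 ≤ S.card ∧
      ∀ ij ∈ S, ∀ t, s (.q ij.1 ij.2) ≤ t → t ≤ e (.q ij.1 ij.2) →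
        CyclesVisible s e t := by
  classical
  obtain ⟨-, hI, hA, hF⟩ := hSP
  have hmeet : ∀ u v, GraphG.Adj u v → s u ≤ e v ∧ s v ≤ e u := by
    intro u v h
    obtain ⟨t, h1, h2, h3, h4⟩ := hA u v h
    omega
  -- the latest starting and the earliest ending cycle vertex
  obtain ⟨mL, -, hL⟩ := Finset.exists_max_image Finset.univ (fun m => s (cyc m)) Finset.univ_nonempty
  obtain ⟨mR, -, hR⟩ := Finset.exists_min_image Finset.univ (fun m => e (cyc m)) Finset.univ_nonempty
  simp only [Finset.mem_univ, forall_true_left] at hL hR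
  have qL := fun i j => hmeet _ _ (adj_qcyc i j mL)
  have qR := fun i j => hmeet _ _ (adj_qcyc i j mR)
  have IL := hI (cyc mL)
  have IR := hI (cyc mR)
  rcases Nat.lt_or_ge (e (cyc mR)) (s (cyc mL)) with hlt | hle
  · exfalso
    -- three consecutive vertices of `A` that pairwise meet
    have a01 := hmeet _ _ (adj_aa 0)
    have a12 := hmeet _ _ (adj_aa 1)
    have a23 := hmeet _ _ (adj_aa 2)
    have a30 := hmeet _ _ (adj_aa 3)
    simp only [show (0 : Fin 4) + 1 = 1 from rfl, show (1 : Fin 4) + 1 = 2 from rfl,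
      show (2 : Fin 4) + 1 = 3 from rfl, show (3 : Fin 4) + 1 = 0 from rfl] at a01 a12 a23 a30
    have main : ∀ k : Fin 4, s (.a k) ≤ e (.a (k + 1)) ∧ s (.a (k + 1)) ≤ e (.a k) →
        s (.a (k + 1)) ≤ e (.a (k + 1 + 1)) ∧ s (.a (k + 1 + 1)) ≤ e (.a (k + 1)) →
        s (.a k) ≤ e (.a (k + 1 + 1)) ∧ s (.a (k + 1 + 1)) ≤ e (.a k) → False := by
      intro k h1 h2 h3
      have L0 : s (.a k) ≤ _ := hL (0, k)
      have L1 : s (.a (k + 1)) ≤ _ := hL (0, k + 1)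
      have L2 : s (.a (k + 1 + 1)) ≤ _ := hL (0, k + 1 + 1)
      have R0 : _ ≤ e (.a k) := hR (0, k)
      have R1 : _ ≤ e (.a (k + 1)) := hR (0, k + 1)
      have R2 : _ ≤ e (.a (k + 1 + 1)) := hR (0, k + 1 + 1)
      have I0 := hI (.a k)
      have I1 := hI (.a (k + 1))
      have I2 := hI (.a (k + 1 + 1))
      obtain ⟨t, ht⟩ : ∃ t, t = max (e (cyc mR))
        (max (s (.a k)) (max (s (.a (k + 1))) (s (.a (k + 1 + 1))))) := ⟨_, rfl⟩
      refine no_three_apexes (hF t (by omega) (by omega)) ?_ k ?_ ?_ ?_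
      · intro i j
        have := qL i j
        have := qR i j
        simp only [Set.mem_ofPred_eq]
        omega
      all_goals
        simp only [Set.mem_ofPred_eq]
        omega
    have m0 := main 0
    have m1 := main 1
    simp only [show (0 : Fin 4) + 1 = 1 from rfl, show (1 : Fin 4) + 1 = 2 from rfl,
      show (2 : Fin 4) + 1 = 3 from rfl] at m0 m1
    by_cases h02 : s (.a 0) ≤ e (.a 2) ∧ s (.a 2) ≤ e (.a 0)
    · exact m0 a01 a12 h02
    · exact m1 a12 a23 (by omega)
  · -- all cycle vertices are visible exactly during `[s (cyc mL), e (cyc mR)]`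
    have vis : ∀ t, s (cyc mL) ≤ t → t ≤ e (cyc mR) → ∀ m, s (cyc m) ≤ t ∧ t ≤ e (cyc m) :=
      fun t h1 h2 m => ⟨(hL m).trans h1, h2.trans (hR m)⟩
    have uniq : ∀ t, s (cyc mL) ≤ t → t ≤ e (cyc mR) → ∀ x y : Fin 4 × Fin 2,
        (s (.q x.1 x.2) ≤ t ∧ t ≤ e (.q x.1 x.2)) → (s (.q y.1 y.2) ≤ t ∧ t ≤ e (.q y.1 y.2)) →
        x = y := by
      intro t h1 h2 x y hx hy
      by_contra hne
      exact no_two_apexes (hF t (by omega) (by omega)) x y hne hx hy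
        (fun k => vis t h1 h2 (0, k)) (vis t h1 h2 (1, 0))
    let BL : Finset (Fin 4 × Fin 2) := Finset.univ.filter fun x => s (.q x.1 x.2) < s (cyc mL)
    let BR : Finset (Fin 4 × Fin 2) := Finset.univ.filter fun x => e (cyc mR) < e (.q x.1 x.2)
    have cL : BL.card ≤ 1 := by
      rw [Finset.card_le_one]
      intro x hx y hy
      simp only [BL, Finset.mem_filter, Finset.mem_univ, true_and] at hx hy
      have := qL x.1 x.2
      have := qL y.1 y.2
      exact uniq (s (cyc mL)) le_rfl hle x y (by omega) (by omega)
    have cR : BR.card ≤ 1 := by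
      rw [Finset.card_le_one]
      intro x hx y hy
      simp only [BR, Finset.mem_filter, Finset.mem_univ, true_and] at hx hy
      have := qR x.1 x.2
      have := qR y.1 y.2
      exact uniq (e (cyc mR)) hle le_rfl x y (by omega) (by omega)
    refine ⟨(BL ∪ BR)ᶜ, ?_, ?_⟩
    · rw [Finset.card_compl]
      have := Finset.card_union_le BL BR
      simp only [Fintype.card_prod, Fintype.card_fin]
      omega
    · intro x hx t h1 h2 k
      simp only [BL, BR, Finset.mem_compl, Finset.mem_union, Finset.mem_filter, Finset.mem_univ,
        true_and] at hx
      have := vis t (by omega) (by omega)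
      exact ⟨this (0, k), this (1, k), this (2, k)⟩
end

section
/- Let J be the graph on 14 vertices consisting of three pairwise vertex-disjoint 4-cycles together with two additional vertices that are not adjacent to each other, each of which is adjacent to all twelve cycle vertices (so J has 36 edges). Then J admits no planar straight-line drawing. -/
/-- `G` admits a planar straight-line drawing: an injective placement of the
vertices in the plane such that no vertex lies in the relative interior of
any edge segment not incident to it, and the closed segments of two distinct
edges intersect only in placements of shared endpoints. -/
def HasPlanarSLDrawing {V : Type*} (G : SimpleGraph V) : Prop :=
  ∃ f : V → ℝ × ℝ,
    Function.Injective f ∧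
    (∀ u v w, G.Adj u v → w ≠ u → w ≠ v → f w ∉ openSegment ℝ (f u) (f v)) ∧
    (∀ u v x y, G.Adj u v → G.Adj x y →
      ¬((u = x ∧ v = y) ∨ (u = y ∧ v = x)) →
      ∀ p ∈ segment ℝ (f u) (f v) ∩ segment ℝ (f x) (f y),
        ∃ z, (z = u ∨ z = v) ∧ (z = x ∨ z = y) ∧ p = f z)

/-- Base relation generating the edges of the graph `J`: three pairwise disjoint
4-cycles (`Sum.inl (c, i)` is the `i`-th vertex of the `c`-th cycle) plus two
mutually non-adjacent vertices `Sum.inr 0`, `Sum.inr 1`, each adjacent to all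
twelve cycle vertices. -/
def JRel : (Fin 3 × Fin 4) ⊕ Fin 2 → (Fin 3 × Fin 4) ⊕ Fin 2 → Prop
  | Sum.inl (c, i), Sum.inl (c', k) => c = c' ∧ k = i + 1
  | Sum.inr _, Sum.inl _ => True
  | _, _ => False

/-- The graph `J` on 14 vertices with 36 edges. -/
def GraphJ : SimpleGraph ((Fin 3 × Fin 4) ⊕ Fin 2) := SimpleGraph.fromRel JRel

/-- The segment from `(px,py)` to `(qx,qy)` meets the path `(0,0) - (rx,ry) - (1,0)`. -/
def MeetsPath (px py qx qy rx ry : ℝ) : Prop :=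
  ∃ s t : ℝ, 0 ≤ s ∧ s ≤ 1 ∧ 0 ≤ t ∧ t ≤ 1 ∧ (1 - s) * py + s * qy = t * ry ∧
    ((1 - s) * px + s * qx = t * rx ∨ (1 - s) * px + s * qx = 1 - t + t * rx)

/-- A segment leaving the triangle `(0,0), (rx,ry), (1,0)` on the side of `r` meets the path. -/
lemma meets_of_exit (px py qx qy rx ry : ℝ) (hr : ry ≠ 0) (hp : 0 ≤ py / ry) (hq : 0 ≤ qy / ry)
    (hA : 0 < px - rx * (py / ry)) (hB : 0 < 1 - px - (1 - rx) * (py / ry))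
    (hQ : qx - rx * (qy / ry) ≤ 0 ∨ 1 - qx - (1 - rx) * (qy / ry) ≤ 0) :
    MeetsPath px py qx qy rx ry := by
  obtain ⟨h, hh⟩ : ∃ h, h = py / ry := ⟨_, rfl⟩
  obtain ⟨k, hk⟩ : ∃ k, k = qy / ry := ⟨_, rfl⟩
  have e1 : py = h * ry := by rw [hh]; field_simp
  have e2 : qy = k * ry := by rw [hk]; field_simp
  rw [← hh] at hp hA hB
  rw [← hk] at hq hQ
  subst e1 e2
  let g : ℝ → ℝ := fun s => min ((1 - s) * (px - rx * h) + s * (qx - rx * k))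
    ((1 - s) * (1 - px - (1 - rx) * h) + s * (1 - qx - (1 - rx) * k))
  have hg : ContinuousOn g (Set.Icc 0 1) := by
    apply Continuous.continuousOn
    fun_prop
  have h0 : (0 : ℝ) ∈ Set.Icc (g 1) (g 0) := by
    constructor
    · simp only [g]
      rcases hQ with hQ | hQ
      · exact (min_le_left _ _).trans (by linarith)
      · exact (min_le_right _ _).trans (by linarith)
    · simp only [g]
      apply le_min <;> linarith
  obtain ⟨s, ⟨hs0, hs1⟩, hs⟩ := intermediate_value_Icc' (zero_le_one) hg h0
  have hl := min_le_left ((1 - s) * (px - rx * h) + s * (qx - rx * k))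
    ((1 - s) * (1 - px - (1 - rx) * h) + s * (1 - qx - (1 - rx) * k))
  have hrr := min_le_right ((1 - s) * (px - rx * h) + s * (qx - rx * k))
    ((1 - s) * (1 - px - (1 - rx) * h) + s * (1 - qx - (1 - rx) * k))
  have hc := min_choice ((1 - s) * (px - rx * h) + s * (qx - rx * k))
    ((1 - s) * (1 - px - (1 - rx) * h) + s * (1 - qx - (1 - rx) * k))
  simp only [g] at hs
  rw [hs] at hl hrr hc
  refine ⟨s, (1 - s) * h + s * k, hs0, hs1, ?_, ?_, by ring, ?_⟩
  · have : 0 ≤ 1 - s := by linarith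
    positivity
  · linarith
  · rcases hc with hc | hc
    · left; linarith
    · right; linarith

/-- Angular order around the origin. -/
def AngLT (px py qx qy : ℝ) : Prop :=
  (py < 0 ∧ 0 ≤ qy) ∨ (py ≤ 0 ∧ 0 < qy) ∨ (0 < py * qy ∧ qx * py < px * qy)

/-- A key realising the angular order. -/
noncomputable def angKey (px py : ℝ) : SignType ×ₗ ℝ := toLex (SignType.sign py, -(px / py))

lemma angKey_lt_iff (px py qx qy : ℝ) :
    angKey px py < angKey qx qy ↔ AngLT px py qx qy := by
  unfold angKey AngLT
  rw [Prod.Lex.toLex_lt_toLex]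
  rcases lt_trichotomy py 0 with hp | hp | hp <;> rcases lt_trichotomy qy 0 with hq | hq | hq
  · have : 0 < py * qy := mul_pos_of_neg_of_neg hp hq
    have e : px / py - qx / qy = (px * qy - qx * py) / (py * qy) := by
      have := hp.ne; have := hq.ne; field_simp
    simp only [sign_neg hp, sign_neg hq, lt_irrefl, false_or, true_and, this, neg_lt_neg_iff,
      not_le.2 hq, not_lt.2 hq.le, and_false]
    rw [← sub_pos, e, div_pos_iff_of_pos_right this, sub_pos]
  · simp [sign_neg hp, hq, hp]
  · simp [sign_neg hp, sign_pos hq, hp, hp.le, hq, hq.le]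
  · simp [sign_neg hq, hp, hq.not_gt]
  · simp [hp, hq]
  · simp [sign_pos hq, hp, hq]
  · have : py * qy < 0 := mul_neg_of_pos_of_neg hp hq
    simp [sign_pos hp, sign_neg hq, hp.not_ge, hp.not_gt, this.not_gt]
  · simp [sign_pos hp, hp.not_gt, hq]
  · have : 0 < py * qy := mul_pos hp hq
    have e : px / py - qx / qy = (px * qy - qx * py) / (py * qy) := by
      have := hp.ne'; have := hq.ne'; field_simp
    simp only [sign_pos hp, sign_pos hq, lt_irrefl, false_or, true_and, this, neg_lt_neg_iff,
      not_le.2 hp, not_lt.2 hp.le, false_and]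
    rw [← sub_pos, e, div_pos_iff_of_pos_right this, sub_pos]

/-- The straight paths `a - p - b` and `a - q - b` with `a = (0,0)`, `b = (1,0)` are compatible. -/
structure PathOK (px py qx qy : ℝ) : Prop where
  ab : ∀ s t : ℝ, 0 ≤ s → s ≤ 1 → 0 ≤ t → t ≤ 1 → s * px = 1 - t + t * qx → s * py = t * qy → False
  aa : ∀ s t : ℝ, 0 ≤ s → s ≤ 1 → 0 ≤ t → t ≤ 1 → s * px = t * qx → s * py = t * qy →
    s * px = 0 ∧ s * py = 0
  ba : ∀ s t : ℝ, 0 ≤ s → s ≤ 1 → 0 ≤ t → t ≤ 1 → s * qx = 1 - t + t * px → s * qy = t * py → False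

lemma PathOK.symm {px py qx qy : ℝ} (h : PathOK px py qx qy) : PathOK qx qy px py :=
  ⟨h.ba, fun s t a b c d e f => by
    have := h.aa t s c d a b e.symm f.symm
    rw [e, f]; exact this, h.ab⟩

lemma PathOK.left_ne {px py qx qy : ℝ} (h : PathOK px py qx qy) : ¬ (px = 0 ∧ py = 0) := by
  rintro ⟨rfl, rfl⟩
  exact h.ba 0 1 (by norm_num) (by norm_num) (by norm_num) (by norm_num) (by ring) (by ring)

lemma PathOK.on_line {px py qx qy : ℝ} (h : PathOK px py qx qy) (hy : py = 0) :
    0 < px ∧ px < 1 := by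
  subst hy
  constructor
  · by_contra hx
    push Not at hx
    have h1 : 0 < 1 - px := by linarith
    refine h.ba 0 (1 / (1 - px)) le_rfl zero_le_one (by positivity) ?_ ?_ (by ring)
    · rw [div_le_one h1]; linarith
    · field_simp; ring
  · by_contra hx
    push Not at hx
    have h1 : 0 < px := by linarith
    refine h.ab (1 / px) 0 (by positivity) ?_ le_rfl zero_le_one ?_ (by ring)
    · rw [div_le_one h1]; linarith
    · field_simp; ring

lemma PathOK.key_ne {px py qx qy : ℝ} (h : PathOK px py qx qy) :
    AngLT px py qx qy ∨ AngLT qx qy px py := by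
  by_contra hc
  unfold AngLT at hc
  push Not at hc
  obtain ⟨⟨h1, h2, h3⟩, h4, h5, h6⟩ := hc
  have hpn := h.left_ne
  have hqn := h.symm.left_ne
  -- it suffices to find nonzero positive multiples agreeing
  have key : ∀ s t : ℝ, 0 < s → 0 < t → s * px = t * qx → s * py = t * qy → False := by
    intro s t hs ht ex ey
    have hst : 0 < s + t := by linarith
    have := h.aa (s / (s + t)) (t / (s + t)) (by positivity) (by rw [div_le_one hst]; linarith)
      (by positivity) (by rw [div_le_one hst]; linarith)
      (by rw [div_mul_eq_mul_div, div_mul_eq_mul_div, ex])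
      (by rw [div_mul_eq_mul_div, div_mul_eq_mul_div, ey])
    have hne : s / (s + t) ≠ 0 := by positivity
    exact hpn ⟨by simpa [hne] using this.1, by simpa [hne] using this.2⟩
  rcases lt_trichotomy py 0 with hp | hp | hp
  · have hq : qy < 0 := h1 hp
    have := mul_pos_of_neg_of_neg hp hq
    exact key (-qy) (-py) (by linarith) (by linarith)
      (by linarith [h3 this, h6 (by linarith)]) (by ring)
  · have hq : qy = 0 := le_antisymm (h2 hp.le) (not_lt.1 fun hn => by linarith [h4 hn])
    have a := h.on_line hp
    have b := h.symm.on_line hq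
    exact key qx px b.1 a.1 (by ring) (by rw [hp, hq]; ring)
  · have hq : 0 < qy := not_le.1 fun hn => by linarith [h5 hn]
    have := mul_pos hp hq
    exact key qy py hq hp
      (by linarith [h3 this, h6 (by linarith)]) (by ring)

/-- On the same side the paths are nested. -/
lemma PathOK.nested {px py qx qy : ℝ} (h : PathOK px py qx qy) (hy : 0 < py * qy)
    (hA : 0 < px - qx * (py / qy)) : 0 < 1 - px - (1 - qx) * (py / qy) := by
  by_contra hB
  push Not at hB
  have hq : qy ≠ 0 := by rintro rfl; simp at hy
  obtain ⟨k, hk⟩ : ∃ k, k = py / qy := ⟨_, rfl⟩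
  have e : py = k * qy := by rw [hk]; field_simp
  rw [← hk] at hA hB
  subst e
  have hk0 : 0 < k := by
    by_contra hn
    push Not at hn
    nlinarith [mul_self_nonneg qy]
  -- the segments `a p` and `b q` meet
  have hD : 0 < px + k - k * qx := by linarith
  refine h.ab (1 / (px + k - k * qx)) (k / (px + k - k * qx)) (by positivity) ?_ (by positivity)
    ?_ ?_ ?_
  · rw [div_le_one hD]; linarith
  · rw [div_le_one hD]; linarith
  · field_simp; ring
  · field_simp

lemma MeetsPath.sub {px py qx qy rx ry ux uy vx vy : ℝ} (a b : ℝ) (ha0 : 0 ≤ a) (ha1 : a ≤ 1)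
    (hb0 : 0 ≤ b) (hb1 : b ≤ 1)
    (hux : ux = (1 - a) * px + a * qx) (huy : uy = (1 - a) * py + a * qy)
    (hvx : vx = (1 - b) * px + b * qx) (hvy : vy = (1 - b) * py + b * qy)
    (h : MeetsPath ux uy vx vy rx ry) : MeetsPath px py qx qy rx ry := by
  obtain ⟨s, t, hs0, hs1, ht0, ht1, hy, hx⟩ := h
  subst hux huy hvx hvy
  refine ⟨(1 - s) * a + s * b, t, ?_, ?_, ht0, ht1, by linarith, ?_⟩
  · have : 0 ≤ 1 - s := by linarith
    positivity
  · nlinarith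
  · rcases hx with hx | hx
    · left; linarith
    · right; linarith

lemma off_eq (px py rx ry : ℝ) (hr : ry ≠ 0) :
    px - rx * (py / ry) = (px * ry - rx * py) / ry := by
  field_simp

lemma edge_aux (px py qx qy rx ry sx sy : ℝ)
    (hpr : PathOK px py rx ry) (hqr : PathOK qx qy rx ry)
    (hps : PathOK px py sx sy) (hqs : PathOK qx qy sx sy)
    (mr : ¬ MeetsPath px py qx qy rx ry) (ms : ¬ MeetsPath px py qx qy sx sy)
    (h1 : AngLT px py rx ry) (h2 : AngLT rx ry qx qy)
    (h3 : AngLT sx sy px py ∨ AngLT qx qy sx sy) : False := by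
  -- consequences of the order for points on one side
  have pos1 : ∀ {ax ay bx b' : ℝ}, 0 < ay → AngLT ax ay bx b' →
      0 < b' ∧ bx * ay < ax * b' := by
    rintro ax ay bx b' h (⟨h', _⟩ | ⟨h', _⟩ | ⟨h', h''⟩)
    · linarith
    · linarith
    · exact ⟨by by_contra hn; push Not at hn; nlinarith, h''⟩
  have neg1 : ∀ {ax ay bx b' : ℝ}, b' < 0 → AngLT ax ay bx b' →
      ay < 0 ∧ bx * ay < ax * b' := by
    rintro ax ay bx b' h (⟨_, h'⟩ | ⟨_, h'⟩ | ⟨h', h''⟩)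
    · linarith
    · linarith
    · exact ⟨by by_contra hn; push Not at hn; nlinarith, h''⟩
  by_cases hp : 0 < py
  · obtain ⟨hr, e1⟩ := pos1 hp h1
    obtain ⟨hq, e2⟩ := pos1 hr h2
    have A : 0 < px - rx * (py / ry) := by
      rw [off_eq _ _ _ _ hr.ne']; exact div_pos (by linarith) hr
    refine mr (meets_of_exit _ _ _ _ _ _ hr.ne' (by positivity) (by positivity) A
      (hpr.nested (by positivity) A) (Or.inl ?_))
    rw [off_eq _ _ _ _ hr.ne']; exact div_nonpos_of_nonpos_of_nonneg (by linarith) hr.le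
  by_cases hq : qy < 0
  · obtain ⟨hr, e2⟩ := neg1 hq h2
    obtain ⟨hp', e1⟩ := neg1 hr h1
    have A : 0 < qx - rx * (qy / ry) := by
      rw [off_eq _ _ _ _ hr.ne]; exact div_pos_of_neg_of_neg (by linarith) hr
    refine mr (MeetsPath.sub 1 0 (by norm_num) (by norm_num) (by norm_num) (by norm_num)
      (by ring) (by ring) (by ring) (by ring)
      (meets_of_exit qx qy px py _ _ hr.ne (div_pos_of_neg_of_neg hq hr).le
        (div_pos_of_neg_of_neg hp' hr).le A
        (hqr.nested (mul_pos_of_neg_of_neg hq hr) A) (Or.inl ?_)))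
    rw [off_eq _ _ _ _ hr.ne]; exact div_nonpos_of_nonneg_of_nonpos (by linarith) hr.le
  push Not at hp hq
  have hlt : py < qy := by
    rcases hp.lt_or_eq with hp' | hp'
    · linarith
    · rcases h1 with ⟨h, _⟩ | ⟨_, h⟩ | ⟨h, _⟩
      · linarith
      · linarith [(pos1 h h2).1]
      · rw [hp'] at h; simp at h
  have hd : 0 < qy - py := by linarith
  obtain ⟨c, hc⟩ : ∃ c, c = -py / (qy - py) := ⟨_, rfl⟩
  have hc0 : 0 ≤ c := by rw [hc]; exact div_nonneg (by linarith) hd.le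
  have hc1 : c ≤ 1 := by rw [hc, div_le_one hd]; linarith
  have hcy : 0 = (1 - c) * py + c * qy := by rw [hc]; field_simp; ring
  obtain ⟨x, hx⟩ : ∃ x, x = (1 - c) * px + c * qx := ⟨_, rfl⟩
  have toP : ∀ {ax ay}, MeetsPath px py x 0 ax ay → MeetsPath px py qx qy ax ay := fun h =>
    MeetsPath.sub 0 c le_rfl zero_le_one hc0 hc1 (by ring) (by ring) hx hcy h
  have fromP : ∀ {ax ay}, MeetsPath x 0 px py ax ay → MeetsPath px py qx qy ax ay := fun h =>
    MeetsPath.sub c 0 hc0 hc1 le_rfl zero_le_one hx hcy (by ring) (by ring) h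
  have toQ : ∀ {ax ay}, MeetsPath qx qy x 0 ax ay → MeetsPath px py qx qy ax ay := fun h =>
    MeetsPath.sub 1 c zero_le_one le_rfl hc0 hc1 (by ring) (by ring) hx hcy h
  have fromQ : ∀ {ax ay}, MeetsPath x 0 qx qy ax ay → MeetsPath px py qx qy ax ay := fun h =>
    MeetsPath.sub c 1 hc0 hc1 zero_le_one le_rfl hx hcy (by ring) (by ring) h
  by_cases hin : 0 < x ∧ x < 1
  · obtain ⟨hx0, hx1⟩ := hin
    rcases lt_trichotomy ry 0 with hr | hr | hr
    · obtain ⟨hp', e1⟩ := neg1 hr h1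
      refine mr (fromP (meets_of_exit _ _ _ _ _ _ hr.ne (by simp)
        (div_pos_of_neg_of_neg hp' hr).le (by simpa using hx0) (by simpa using hx1) (Or.inl ?_)))
      rw [off_eq _ _ _ _ hr.ne]; exact div_nonpos_of_nonneg_of_nonpos (by linarith) hr.le
    · obtain ⟨r0, r1⟩ := hpr.symm.on_line hr
      apply mr
      rcases le_total x rx with hle | hle
      · refine ⟨c, x / rx, hc0, hc1, by positivity, by rw [div_le_one r0]; exact hle, ?_, Or.inl ?_⟩
        · rw [← hcy, hr]; ring
        · rw [← hx]; field_simp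
      · have h1r : 0 < 1 - rx := by linarith
        refine ⟨c, (1 - x) / (1 - rx), hc0, hc1, div_nonneg (by linarith) h1r.le,
          by rw [div_le_one h1r]; linarith, ?_, Or.inr ?_⟩
        · rw [← hcy, hr]; ring
        · rw [← hx]; field_simp; ring
    · obtain ⟨hq', e2⟩ := pos1 hr h2
      refine mr (fromQ (meets_of_exit _ _ _ _ _ _ hr.ne' (by simp)
        (by positivity) (by simpa using hx0) (by simpa using hx1) (Or.inl ?_)))
      rw [off_eq _ _ _ _ hr.ne']; exact div_nonpos_of_nonpos_of_nonneg (by linarith) hr.le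
  · have hout : x ≤ 0 ∨ 1 - x ≤ 0 := by
      by_contra hn
      push Not at hn
      exact hin ⟨hn.1, by linarith⟩
    rcases h3 with h3 | h3
    · have hp' : py < 0 := by
        rcases hp.lt_or_eq with hp' | hp'
        · exact hp'
        · exfalso
          have : c = 0 := by rw [hc, hp']; simp
          rw [this] at hx
          exact hin (by rw [hx]; simpa using hpr.on_line hp')
      obtain ⟨hs, e⟩ := neg1 hp' h3
      have A : 0 < px - sx * (py / sy) := by
        rw [off_eq _ _ _ _ hs.ne]; exact div_pos_of_neg_of_neg (by linarith) hs
      exact ms (toP (meets_of_exit _ _ _ _ _ _ hs.ne (div_pos_of_neg_of_neg hp' hs).le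
        (by simp) A (hps.nested (mul_pos_of_neg_of_neg hp' hs) A) (by simpa using hout)))
    · have hq' : 0 < qy := by
        rcases hq.lt_or_eq with hq' | hq'
        · exact hq'
        · exfalso
          have : c = 1 := by
            rw [hc, ← hq']; rw [← hq'] at hd
            field_simp; ring
          rw [this] at hx
          exact hin (by rw [hx]; simpa using hqr.on_line hq'.symm)
      obtain ⟨hs, e⟩ := pos1 hq' h3
      have A : 0 < qx - sx * (qy / sy) := by
        rw [off_eq _ _ _ _ hs.ne']; exact div_pos (by linarith) hs
      exact ms (toQ (meets_of_exit _ _ _ _ _ _ hs.ne' (by positivity)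
        (by simp) A (hqs.nested (by positivity) A) (by simpa using hout)))

/-- `r` lies strictly between `p` and `q`. -/
def BtwKey {α : Type*} [LinearOrder α] (p q r : α) : Prop := (p < r ∧ r < q) ∨ (q < r ∧ r < p)

/-- Four edges of a 4-cycle cannot all be adjacent in the cyclic order on five elements. -/
lemma order_aux {α : Type*} [LinearOrder α] (a b c d e : α) 
    (ab : a ≠ b) (ac : a ≠ c) (ad : a ≠ d) (ae : a ≠ e) (bc : b ≠ c) (bd : b ≠ d) (be : b ≠ e)
    (cd : c ≠ d) (ce : c ≠ e) (de : d ≠ e)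
    (h1 : (BtwKey a b c ↔ BtwKey a b e) ∧ (BtwKey a b d ↔ BtwKey a b e))
    (h2 : (BtwKey b c d ↔ BtwKey b c e) ∧ (BtwKey b c a ↔ BtwKey b c e))
    (h3 : (BtwKey c d a ↔ BtwKey c d e) ∧ (BtwKey c d b ↔ BtwKey c d e))
    (h4 : (BtwKey d a b ↔ BtwKey d a e) ∧ (BtwKey d a c ↔ BtwKey d a e)) : False := by
  unfold BtwKey at *
  rcases lt_or_gt_of_ne ab with h | h <;> rcases lt_or_gt_of_ne ac with h' | h' <;> 
   rcases lt_or_gt_of_ne ad with h'' | h'' <;> rcases lt_or_gt_of_ne ae with g4 | g4 <;> grind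

lemma edge_btw (px py qx qy rx ry sx sy : ℝ)
    (hpr : PathOK px py rx ry) (hqr : PathOK qx qy rx ry)
    (hps : PathOK px py sx sy) (hqs : PathOK qx qy sx sy)
    (mr : ¬ MeetsPath px py qx qy rx ry) (ms : ¬ MeetsPath px py qx qy sx sy)
    (h : BtwKey (angKey px py) (angKey qx qy) (angKey rx ry)) :
    BtwKey (angKey px py) (angKey qx qy) (angKey sx sy) := by
  have flip : ∀ {ax ay : ℝ}, ¬ MeetsPath px py qx qy ax ay → ¬ MeetsPath qx qy px py ax ay :=
    fun hn hm => hn (MeetsPath.sub 1 0 (by norm_num) (by norm_num) (by norm_num) (by norm_num)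
      (by ring) (by ring) (by ring) (by ring) hm)
  have k1 := hps.key_ne
  have k2 := hqs.key_ne
  have e1 := edge_aux px py qx qy rx ry sx sy hpr hqr hps hqs mr ms
  have e2 := edge_aux qx qy px py rx ry sx sy hqr hpr hqs hps (flip mr) (flip ms)
  simp only [← angKey_lt_iff] at k1 k2 e1 e2
  unfold BtwKey at *
  tauto

lemma mem_seg (P Q p : ℝ × ℝ) (s : ℝ) (h0 : 0 ≤ s) (h1 : s ≤ 1)
    (hx : p.1 = (1 - s) * P.1 + s * Q.1) (hy : p.2 = (1 - s) * P.2 + s * Q.2) :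
    p ∈ segment ℝ P Q :=
  ⟨1 - s, s, by linarith, h0, by ring, by ext <;> simp [hx, hy]⟩

/-- The graph `J` (three disjoint 4-cycles plus two
non-adjacent vertices adjacent to all twelve cycle vertices) admits no planar
straight-line drawing. -/
theorem GraphJ_not_planar_SL : ¬ HasPlanarSLDrawing GraphJ := by
  rintro ⟨f, hinj, -, hseg⟩
  have adjA : ∀ (k : Fin 2) (u : Fin 3 × Fin 4), GraphJ.Adj (Sum.inr k) (Sum.inl u) := by
    intro k u
    simp [GraphJ, SimpleGraph.fromRel_adj, JRel]
  have adjC : ∀ (c : Fin 3) (i : Fin 4), GraphJ.Adj (Sum.inl (c, i)) (Sum.inl (c, i + 1)) := by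
    intro c i
    simp [GraphJ, SimpleGraph.fromRel_adj, JRel]
  have hab : f (Sum.inr 0) ≠ f (Sum.inr 1) := hinj.ne (by simp)
  set a := f (Sum.inr 0) with ha
  set b := f (Sum.inr 1) with hb
  obtain ⟨d1, hd1⟩ : ∃ d, d = b.1 - a.1 := ⟨_, rfl⟩
  obtain ⟨d2, hd2⟩ : ∃ d, d = b.2 - a.2 := ⟨_, rfl⟩
  have hD : d1 ^ 2 + d2 ^ 2 ≠ 0 := by
    intro h
    have h1 : d1 = 0 := by nlinarith [sq_nonneg d1, sq_nonneg d2]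
    have h2 : d2 = 0 := by nlinarith [sq_nonneg d1, sq_nonneg d2]
    exact hab (Prod.ext (by linarith) (by linarith))
  obtain ⟨X, hX⟩ : ∃ X : Fin 3 × Fin 4 → ℝ, ∀ u, X u =
    (((f (Sum.inl u)).1 - a.1) * d1 + ((f (Sum.inl u)).2 - a.2) * d2) / (d1 ^ 2 + d2 ^ 2) :=
    ⟨_, fun _ => rfl⟩
  obtain ⟨Y, hY⟩ : ∃ Y : Fin 3 × Fin 4 → ℝ, ∀ u, Y u =
    (((f (Sum.inl u)).2 - a.2) * d1 - ((f (Sum.inl u)).1 - a.1) * d2) / (d1 ^ 2 + d2 ^ 2) :=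
    ⟨_, fun _ => rfl⟩
  have f1 : ∀ u, (f (Sum.inl u)).1 = a.1 + X u * d1 - Y u * d2 := by
    intro u; rw [hX, hY]; field_simp; ring
  have f2 : ∀ u, (f (Sum.inl u)).2 = a.2 + X u * d2 + Y u * d1 := by
    intro u; rw [hX, hY]; field_simp; ring
  have b1 : b.1 = a.1 + d1 := by linarith
  have b2 : b.2 = a.2 + d2 := by linarith
  -- edges `a u` and `b v` are disjoint
  have hABd : ∀ u v : Fin 3 × Fin 4, u ≠ v → ∀ s t : ℝ, 0 ≤ s → s ≤ 1 → 0 ≤ t → t ≤ 1 →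
      s * X u = 1 - t + t * X v → s * Y u = t * Y v → False := by
    intro u v huv s t hs0 hs1 ht0 ht1 ex ey
    obtain ⟨z, hz1, hz2, -⟩ := hseg _ _ _ _ (adjA 0 u) (adjA 1 v) (by simp)
      ((1 - s) * a.1 + s * (f (Sum.inl u)).1, (1 - s) * a.2 + s * (f (Sum.inl u)).2)
      ⟨mem_seg _ _ _ s hs0 hs1 rfl rfl, mem_seg _ _ _ t ht0 ht1
        (by simp only [← hb, f1, b1]; linear_combination d1 * ex - d2 * ey)
        (by simp only [← hb, f2, b2]; linear_combination d2 * ex + d1 * ey)⟩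
    rcases hz1 with rfl | rfl <;> simp [huv] at hz2
  have hPath : ∀ u v : Fin 3 × Fin 4, u ≠ v → PathOK (X u) (Y u) (X v) (Y v) := by
    intro u v huv
    refine ⟨hABd u v huv, ?_, hABd v u huv.symm⟩
    intro s t hs0 hs1 ht0 ht1 ex ey
    obtain ⟨z, hz1, hz2, hz⟩ := hseg _ _ _ _ (adjA 0 u) (adjA 0 v) (by simp [huv])
      ((1 - s) * a.1 + s * (f (Sum.inl u)).1, (1 - s) * a.2 + s * (f (Sum.inl u)).2)
      ⟨mem_seg _ _ _ s hs0 hs1 rfl rfl, mem_seg _ _ _ t ht0 ht1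
        (by simp only [← ha, f1]; linear_combination d1 * ex - d2 * ey)
        (by simp only [← ha, f2]; linear_combination d2 * ex + d1 * ey)⟩
    have hza : z = Sum.inr 0 := by
      rcases hz1 with rfl | rfl
      · rfl
      · simp [huv] at hz2
    rw [hza, ← ha, Prod.ext_iff] at hz
    simp only [f1, f2] at hz
    obtain ⟨g1, g2⟩ := hz
    constructor
    · have : (s * X u) * (d1 ^ 2 + d2 ^ 2) = 0 := by linear_combination d1 * g1 + d2 * g2
      simpa [hD] using this
    · have : (s * Y u) * (d1 ^ 2 + d2 ^ 2) = 0 := by linear_combination d1 * g2 - d2 * g1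
      simpa [hD] using this
  have hMeet : ∀ u v w : Fin 3 × Fin 4, GraphJ.Adj (Sum.inl u) (Sum.inl v) → w ≠ u → w ≠ v →
      ¬ MeetsPath (X u) (Y u) (X v) (Y v) (X w) (Y w) := by
    rintro u v w huv hwu hwv ⟨s, t, hs0, hs1, ht0, ht1, ey, ex | ex⟩
    · obtain ⟨z, hz1, hz2, -⟩ := hseg _ _ _ _ huv (adjA 0 w) (by simp)
        ((1 - s) * (f (Sum.inl u)).1 + s * (f (Sum.inl v)).1,
          (1 - s) * (f (Sum.inl u)).2 + s * (f (Sum.inl v)).2)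
        ⟨mem_seg _ _ _ s hs0 hs1 rfl rfl, mem_seg _ _ _ t ht0 ht1
          (by simp only [← ha, f1]; linear_combination d1 * ex - d2 * ey)
          (by simp only [← ha, f2]; linear_combination d2 * ex + d1 * ey)⟩
      rcases hz1 with rfl | rfl <;> simp [hwu.symm, hwv.symm] at hz2
    · obtain ⟨z, hz1, hz2, -⟩ := hseg _ _ _ _ huv (adjA 1 w) (by simp)
        ((1 - s) * (f (Sum.inl u)).1 + s * (f (Sum.inl v)).1,
          (1 - s) * (f (Sum.inl u)).2 + s * (f (Sum.inl v)).2)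
        ⟨mem_seg _ _ _ s hs0 hs1 rfl rfl, mem_seg _ _ _ t ht0 ht1
          (by simp only [← hb, f1, b1]; linear_combination d1 * ex - d2 * ey)
          (by simp only [← hb, f2, b2]; linear_combination d2 * ex + d1 * ey)⟩
      rcases hz1 with rfl | rfl <;> simp [hwu.symm, hwv.symm] at hz2
  let k : Fin 3 × Fin 4 → SignType ×ₗ ℝ := fun u => angKey (X u) (Y u)
  have kne : ∀ u v : Fin 3 × Fin 4, u ≠ v → k u ≠ k v := by
    intro u v huv
    have := (hPath u v huv).key_ne
    simp only [← angKey_lt_iff] at this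
    exact this.elim ne_of_lt ne_of_gt
  have kb : ∀ u v w w' : Fin 3 × Fin 4, GraphJ.Adj (Sum.inl u) (Sum.inl v) → w ≠ u → w ≠ v →
      w' ≠ u → w' ≠ v → (BtwKey (k u) (k v) (k w) ↔ BtwKey (k u) (k v) (k w')) := by
    intro u v w w' huv h1 h2 h3 h4
    constructor
    · exact edge_btw _ _ _ _ _ _ _ _ (hPath _ _ h1.symm) (hPath _ _ h2.symm) (hPath _ _ h3.symm)
        (hPath _ _ h4.symm) (hMeet _ _ _ huv h1 h2) (hMeet _ _ _ huv h3 h4)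
    · exact edge_btw _ _ _ _ _ _ _ _ (hPath _ _ h3.symm) (hPath _ _ h4.symm) (hPath _ _ h1.symm)
        (hPath _ _ h2.symm) (hMeet _ _ _ huv h3 h4) (hMeet _ _ _ huv h1 h2)
  refine order_aux (k (0, 0)) (k (0, 1)) (k (0, 2)) (k (0, 3)) (k (1, 0))
    ?_ ?_ ?_ ?_ ?_ ?_ ?_ ?_ ?_ ?_ ⟨?_, ?_⟩ ⟨?_, ?_⟩ ⟨?_, ?_⟩ ⟨?_, ?_⟩
  on_goal 11 => exact kb _ _ _ _ (adjC 0 0) (by decide) (by decide) (by decide) (by decide)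
  on_goal 11 => exact kb _ _ _ _ (adjC 0 0) (by decide) (by decide) (by decide) (by decide)
  on_goal 11 => exact kb _ _ _ _ (adjC 0 1) (by decide) (by decide) (by decide) (by decide)
  on_goal 11 => exact kb _ _ _ _ (adjC 0 1) (by decide) (by decide) (by decide) (by decide)
  on_goal 11 => exact kb _ _ _ _ (adjC 0 2) (by decide) (by decide) (by decide) (by decide)
  on_goal 11 => exact kb _ _ _ _ (adjC 0 2) (by decide) (by decide) (by decide) (by decide)
  on_goal 11 => exact kb _ _ _ _ (adjC 0 3) (by decide) (by decide) (by decide) (by decide)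
  on_goal 11 => exact kb _ _ _ _ (adjC 0 3) (by decide) (by decide) (by decide) (by decide)
  all_goals exact kne _ _ (by decide)
end
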